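/- arXiv:1705.00189 — 2 statements merged into one kernel-verified Lean document; each statement's English description precedes it below -/
import Mathlib

section
/- The only even positive integer N satisfying σ**(σ**(N)) = 2N is N = 2. -/
def IsUnitaryDivisor (d n : ℕ) : Prop := d ∣ n ∧ Nat.gcd d (n / d) = 1

def IsBiunitaryDivisor (d n : ℕ) : Prop :=
  d ∣ n ∧ ∀ c, IsUnitaryDivisor c d → IsUnitaryDivisor c (n / d) → c = 1

open scoped Classical in
noncomputable def sbu (n : ℕ) : ℕ :=
  ∑ d ∈ n.divisors.filter (fun d => IsBiunitaryDivisor d n), d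

theorem sbu_mul (a b : ℕ) (h : Nat.Coprime a b) : sbu (a * b) = sbu a * sbu b := by
  classical
  rcases Nat.eq_zero_or_pos a with rfl | ha
  · simp [sbu]
  rcases Nat.eq_zero_or_pos b with rfl | hb
  · simp [sbu]
  have key : ∀ x y, x ∣ a → y ∣ b →
      (IsBiunitaryDivisor (x * y) (a * b) ↔ IsBiunitaryDivisor x a ∧ IsBiunitaryDivisor y b) := by
    rintro x y ⟨x', rfl⟩ ⟨y', rfl⟩
    have hx : 0 < x := Nat.pos_of_mul_pos_right ha
    have hy : 0 < y := Nat.pos_of_mul_pos_right hb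
    have e1 : x * x' * (y * y') / (x * y) = x' * y' := by
      rw [show x * x' * (y * y') = (x * y) * (x' * y') by ring]
      exact Nat.mul_div_cancel_left _ (by positivity)
    have e2 : x * x' / x = x' := Nat.mul_div_cancel_left _ hx
    have e3 : y * y' / y = y' := Nat.mul_div_cancel_left _ hy
    have hxy : Nat.Coprime x y := h.coprime_mul_right.coprime_mul_right_right
    have hxy' : Nat.Coprime x y' := h.coprime_mul_right.coprime_mul_left_right
    have hx'y : Nat.Coprime x' y := h.coprime_mul_left.coprime_mul_right_right
    have hx'y' : Nat.Coprime x' y' := h.coprime_mul_left.coprime_mul_left_right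
    have lift : ∀ c u w : ℕ, 0 < u → Nat.Coprime u w → IsUnitaryDivisor c u →
        IsUnitaryDivisor c (u * w) := by
      rintro c u w hu huw ⟨⟨v, rfl⟩, hc⟩
      have hc0 : 0 < c := Nat.pos_of_mul_pos_right hu
      refine ⟨⟨v * w, by ring⟩, ?_⟩
      rw [mul_assoc, Nat.mul_div_cancel_left _ hc0]
      rw [Nat.mul_div_cancel_left _ hc0] at hc
      exact Nat.Coprime.mul_right hc (huw.coprime_mul_right)
    have hx' : 0 < x' := Nat.pos_of_mul_pos_left ha
    have hy' : 0 < y' := Nat.pos_of_mul_pos_left hb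
    have down : ∀ c1 c2 u w : ℕ, 0 < u → 0 < w → c1 ∣ u → c2 ∣ w → IsUnitaryDivisor (c1 * c2) (u * w) →
        IsUnitaryDivisor c1 u ∧ IsUnitaryDivisor c2 w := by
      rintro c1 c2 u w hu hw ⟨u', rfl⟩ ⟨w', rfl⟩ ⟨_, hc⟩
      have h1 : 0 < c1 := Nat.pos_of_mul_pos_right hu
      have h2 : 0 < c2 := Nat.pos_of_mul_pos_right hw
      rw [show c1 * u' * (c2 * w') = (c1 * c2) * (u' * w') by ring,
        Nat.mul_div_cancel_left _ (by positivity)] at hc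
      have hc : Nat.Coprime (c1 * c2) (u' * w') := hc
      refine ⟨⟨⟨u', rfl⟩, ?_⟩, ⟨⟨w', rfl⟩, ?_⟩⟩
      · rw [Nat.mul_div_cancel_left _ h1]
        exact hc.coprime_mul_right.coprime_mul_right_right
      · rw [Nat.mul_div_cancel_left _ h2]
        exact hc.coprime_mul_left.coprime_mul_left_right
    unfold IsBiunitaryDivisor
    rw [e1, e2, e3]
    constructor
    · rintro ⟨_, hc⟩
      refine ⟨⟨⟨x', rfl⟩, fun c h1 h2 => hc c (lift _ _ _ hx hxy h1) (lift _ _ _ hx' hx'y' h2)⟩,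
        ⟨⟨y', rfl⟩, fun c h1 h2 => hc c ?_ ?_⟩⟩
      · rw [mul_comm]; exact lift _ _ _ hy hxy.symm h1
      · rw [mul_comm]; exact lift _ _ _ hy' hx'y'.symm h2
    · rintro ⟨⟨_, hc1⟩, ⟨_, hc2⟩⟩
      refine ⟨⟨x' * y', by ring⟩, fun c h1 h2 => ?_⟩
      obtain ⟨c1, c2, hd1, hd2, rfl⟩ := exists_dvd_and_dvd_of_dvd_mul h1.1
      have g1 : c1 ∣ x' := by
        have : c1 ∣ x' * y' := (Dvd.intro _ rfl).trans h2.1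
        exact (Nat.Coprime.coprime_dvd_left hd1 hxy').dvd_of_dvd_mul_right this
      have g2 : c2 ∣ y' := by
        have : c2 ∣ x' * y' := (Dvd.intro_left _ rfl).trans h2.1
        exact (Nat.Coprime.coprime_dvd_left hd2 hx'y.symm).dvd_of_dvd_mul_left this
      obtain ⟨k1, k2⟩ := down _ _ _ _ hx hy hd1 hd2 h1
      obtain ⟨k3, k4⟩ := down _ _ _ _ hx' hy' g1 g2 h2
      rw [hc1 _ k1 k3, hc2 _ k2 k4, mul_one]
  unfold sbu
  rw [Finset.sum_filter, Finset.sum_filter, Finset.sum_filter, Nat.divisors_mul, Finset.mul_def,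
    Finset.sum_image (by
      intro x hx y hy hxy
      exact h.mul_injOn_divisors (by simpa using hx) (by simpa using hy) hxy),
    Finset.sum_product, Finset.sum_mul_sum]
  refine Finset.sum_congr rfl fun x hx => Finset.sum_congr rfl fun y hy => ?_
  have := key x y (Nat.dvd_of_mem_divisors hx) (Nat.dvd_of_mem_divisors hy)
  simp only [this]
  by_cases h1 : IsBiunitaryDivisor x a <;> by_cases h2 : IsBiunitaryDivisor y b <;> simp [h1, h2]

theorem biu_prime_pow {p : ℕ} (hp : p.Prime) (e i : ℕ) (hi : i ≤ e) :
    IsBiunitaryDivisor (p ^ i) (p ^ e) ↔ (e = 0 ∨ 2 * i ≠ e) := by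
  have hU : ∀ j c, IsUnitaryDivisor c (p ^ j) → c = 1 ∨ c = p ^ j := by
    rintro j c ⟨hc, hg⟩
    obtain ⟨i, hi, rfl⟩ := (Nat.dvd_prime_pow hp).1 hc
    rw [Nat.pow_div hi hp.pos] at hg
    by_contra hcon
    push Not at hcon
    have h1 : i ≠ 0 := by rintro rfl; simp at hcon
    have h2 : j - i ≠ 0 := by
      intro h; have : i = j := by omega
      subst this; simp at hcon
    have : p ∣ Nat.gcd (p ^ i) (p ^ (j - i)) := Nat.dvd_gcd (dvd_pow_self _ h1) (dvd_pow_self _ h2)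
    rw [hg] at this
    exact hp.one_lt.ne' (Nat.dvd_one.1 this)
  have hS : ∀ j, IsUnitaryDivisor (p ^ j) (p ^ j) := fun j =>
    ⟨dvd_rfl, by rw [Nat.div_self (pow_pos hp.pos _)]; simp⟩
  unfold IsBiunitaryDivisor
  rw [Nat.pow_div hi hp.pos]
  constructor
  · rintro ⟨_, h⟩
    by_contra hcon
    push Not at hcon
    obtain ⟨h0, h2⟩ := hcon
    have : e - i = i := by omega
    rw [this] at h
    have := h _ (hS i) (hS i)
    rw [Nat.pow_eq_one] at this
    have := hp.one_lt
    omega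
  · intro h
    refine ⟨pow_dvd_pow _ hi, fun c h1 h2 => ?_⟩
    rcases hU _ _ h1 with h1 | h1
    · exact h1
    rcases hU _ _ h2 with h2 | h2
    · exact h2
    have : i = e - i := Nat.pow_right_injective hp.two_le (h1.symm.trans h2)
    have : i = 0 := by omega
    subst this; simpa using h1

theorem sbu_prime_pow {p : ℕ} (hp : p.Prime) (e : ℕ) :
    sbu (p ^ e) = ∑ i ∈ (Finset.range (e + 1)).filter (fun i => e = 0 ∨ 2 * i ≠ e), p ^ i := by
  classical
  unfold sbu
  rw [Finset.sum_filter, Nat.sum_divisors_prime_pow hp, Finset.sum_filter]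
  apply Finset.sum_congr rfl
  intro i hi
  have := biu_prime_pow hp e i (by simpa [Nat.lt_succ_iff] using hi)
  simp only [this]

theorem sbu_odd {p : ℕ} (hp : p.Prime) (k : ℕ) :
    sbu (p ^ (2 * k + 1)) = ∑ i ∈ Finset.range (2 * k + 2), p ^ i := by
  rw [sbu_prime_pow hp, Finset.filter_true_of_mem]
  intro i _; right; omega

theorem sbu_even {p : ℕ} (hp : p.Prime) (k : ℕ) (hk : k ≠ 0) :
    sbu (p ^ (2 * k)) = (∑ i ∈ Finset.range k, p ^ i) * (p ^ (k + 1) + 1) := by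
  have : (Finset.range (2 * k + 1)).filter (fun i => 2 * k = 0 ∨ 2 * i ≠ 2 * k)
      = (Finset.range (2 * k + 1)).erase k := by
    ext i; simp; omega
  rw [sbu_prime_pow hp, this]
  have h1 := Finset.add_sum_erase (Finset.range (2 * k + 1)) (fun i => p ^ i) (a := k) (by simp; omega)
  have h2 : ∑ i ∈ Finset.range (2 * k + 1), p ^ i =
    ∑ i ∈ Finset.range k, p ^ i + p ^ k + p ^ (k + 1) * ∑ i ∈ Finset.range k, p ^ i := by
    rw [show 2 * k + 1 = (k + 1) + k by ring, Finset.sum_range_add, Finset.sum_range_succ,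
      Finset.mul_sum]
    simp [pow_add]
  rw [h2] at h1
  linarith

theorem sbu_one : sbu 1 = 1 := by
  have := sbu_prime_pow Nat.prime_two 0
  simpa using this

theorem isBiu_self {n : ℕ} (hn : 0 < n) : IsBiunitaryDivisor n n := by
  refine ⟨dvd_rfl, fun c _ h => ?_⟩
  rw [Nat.div_self hn] at h
  exact Nat.dvd_one.1 h.1

theorem isBiu_one (n : ℕ) : IsBiunitaryDivisor 1 n :=
  ⟨one_dvd _, fun _ h _ => Nat.dvd_one.1 h.1⟩

theorem le_sbu {n : ℕ} (hn : 0 < n) : n ≤ sbu n := by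
  classical
  unfold sbu
  exact Finset.single_le_sum (f := fun d => d) (fun _ _ => Nat.zero_le _)
    (by simp [hn.ne', isBiu_self hn])

theorem succ_le_sbu {n : ℕ} (hn : 1 < n) : n + 1 ≤ sbu n := by
  classical
  unfold sbu
  have : ∑ d ∈ ({n, 1} : Finset ℕ), d ≤
      ∑ d ∈ n.divisors.filter (fun d => IsBiunitaryDivisor d n), d := by
    apply Finset.sum_le_sum_of_subset
    intro x hx
    simp only [Finset.mem_insert, Finset.mem_singleton] at hx
    rcases hx with rfl | rfl
    · simp [isBiu_self (by omega : 0 < x)]; omega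
    · simp [isBiu_one]; omega
  rwa [Finset.sum_pair (by omega)] at this

theorem sbu_pos {n : ℕ} (hn : 0 < n) : 0 < sbu n := lt_of_lt_of_le hn (le_sbu hn)

theorem sbu_prod {n : ℕ} (hn : n ≠ 0) :
    sbu n = ∏ p ∈ n.primeFactors, sbu (p ^ n.factorization p) :=
  Nat.multiplicative_factorization sbu sbu_mul sbu_one hn

theorem sbu_pow_dvd {n p : ℕ} (hn : n ≠ 0) : sbu (p ^ n.factorization p) ∣ sbu n := by
  by_cases hp : p ∈ n.primeFactors
  · rw [sbu_prod hn]
    exact Finset.dvd_prod_of_mem (fun p => sbu (p ^ n.factorization p)) hp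
  · rw [← Nat.support_factorization, Finsupp.notMem_support_iff] at hp
    simp [hp, sbu_one]

theorem two_dvd_geom {p k : ℕ} (hp : Odd p) (hk : Even k) :
    2 ∣ ∑ i ∈ Finset.range k, p ^ i := by
  obtain ⟨j, rfl⟩ := hk
  induction j with
  | zero => simp
  | succ j ih =>
    rw [show j + 1 + (j + 1) = j + j + 1 + 1 by ring, Finset.sum_range_succ, Finset.sum_range_succ,
      add_assoc]
    exact dvd_add ih ((hp.pow.add_odd hp.pow).two_dvd)

theorem succ_dvd_geom {p k : ℕ} (hk : Even k) :
    p + 1 ∣ ∑ i ∈ Finset.range k, p ^ i := by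
  obtain ⟨j, rfl⟩ := hk
  induction j with
  | zero => simp
  | succ j ih =>
    rw [show j + 1 + (j + 1) = j + j + 1 + 1 by ring, Finset.sum_range_succ, Finset.sum_range_succ,
      add_assoc]
    exact dvd_add ih ⟨p ^ (j + j), by ring⟩

theorem two_dvd_sbu_pow {p e : ℕ} (hp : p.Prime) (hp2 : p ≠ 2) (he : e ≠ 0) :
    2 ∣ sbu (p ^ e) := by
  have ho := hp.odd_of_ne_two hp2
  obtain ⟨k, hk | hk⟩ := Nat.even_or_odd' e
  · subst hk
    rw [sbu_even hp k (by omega)]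
    exact Dvd.dvd.mul_left ((ho.pow.add_odd odd_one).two_dvd) _
  · subst hk
    rw [sbu_odd hp k]
    exact two_dvd_geom ho ⟨k + 1, by ring⟩

theorem two_pow_card_dvd {n : ℕ} (hn : n ≠ 0) (S : Finset ℕ)
    (hS : ∀ p ∈ S, p.Prime ∧ p ≠ 2 ∧ p ∣ n) : 2 ^ S.card ∣ sbu n := by
  rw [sbu_prod hn]
  have h1 : S ⊆ n.primeFactors := fun p hp => by
    obtain ⟨h1, h2, h3⟩ := hS p hp
    exact Nat.mem_primeFactors.2 ⟨h1, h3, hn⟩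
  refine dvd_trans ?_ (Finset.prod_dvd_prod_of_subset _ _ _ h1)
  rw [← Finset.prod_const]
  refine Finset.prod_dvd_prod_of_dvd _ _ fun p hp => ?_
  obtain ⟨h1, h2, h3⟩ := hS p hp
  exact two_dvd_sbu_pow h1 h2 (h1.factorization_pos_of_dvd hn h3).ne'

noncomputable def hb (n : ℕ) : ℚ := (sbu n : ℚ) / n

theorem hb_mul (a b : ℕ) (h : Nat.Coprime a b) : hb (a * b) = hb a * hb b := by
  unfold hb
  rw [sbu_mul a b h]
  push_cast
  rw [mul_div_mul_comm]

theorem hb_one : hb 1 = 1 := by simp [hb, sbu_one]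

theorem one_le_hb {n : ℕ} (hn : 0 < n) : 1 ≤ hb n := by
  unfold hb
  rw [le_div_iff₀ (by exact_mod_cast hn), one_mul]
  exact_mod_cast le_sbu hn

theorem hb_prod_le {n : ℕ} (hn : n ≠ 0) (S : Finset ℕ) (hS : ∀ p ∈ S, p.Prime) :
    ∏ p ∈ S, hb (p ^ n.factorization p) ≤ hb n := by
  classical
  have h1 : hb n = ∏ p ∈ n.primeFactors, hb (p ^ n.factorization p) :=
    Nat.multiplicative_factorization hb hb_mul hb_one hn
  have h2 : ∏ p ∈ n.primeFactors, hb (p ^ n.factorization p)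
      = ∏ p ∈ n.primeFactors ∪ S, hb (p ^ n.factorization p) := by
    apply Finset.prod_subset Finset.subset_union_left
    intro p _ hp
    rw [← Nat.support_factorization, Finsupp.notMem_support_iff] at hp
    simp [hp, hb_one]
  rw [h1, h2]
  have h3 : ∀ p ∈ n.primeFactors ∪ S, 1 ≤ hb (p ^ n.factorization p) := by
    intro p hp
    have : p.Prime := by
      rcases Finset.mem_union.1 hp with h | h
      · exact Nat.prime_of_mem_primeFactors h
      · exact hS p h
    exact one_le_hb (pow_pos this.pos _)
  apply Finset.prod_le_prod_of_subset_of_one_le Finset.subset_union_right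
  · intro p hp
    exact zero_le_one.trans (h3 p (Finset.mem_union_right _ hp))
  · intro p hp _
    exact h3 p hp

theorem sbu_pow_lower {p e : ℕ} (hp : p.Prime) (T : Finset ℕ)
    (hT : ∀ i ∈ T, i ≤ e ∧ 2 * i ≠ e) : ∑ i ∈ T, p ^ i ≤ sbu (p ^ e) := by
  rw [sbu_prime_pow hp]
  apply Finset.sum_le_sum_of_subset
  intro i hi
  have := hT i hi
  simp; omega

theorem hb_two_val {p : ℕ} (hp : p.Prime) : hb (p ^ 2) = 1 + 1 / (p : ℚ) ^ 2 := by
  have h := sbu_even hp 1 one_ne_zero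
  have h0 : (p : ℚ) ≠ 0 := by exact_mod_cast hp.ne_zero
  simp at h
  unfold hb
  rw [h]; push_cast; field_simp

theorem hb_ne_two {p e : ℕ} (hp : p.Prime) (h0 : e ≠ 0) (h2 : e ≠ 2) :
    1 + 1 / (p : ℚ) ≤ hb (p ^ e) := by
  have h := sbu_pow_lower hp (e := e) {e - 1, e} (by
    intro i hi; simp only [Finset.mem_insert, Finset.mem_singleton] at hi; omega)
  rw [Finset.sum_pair (by omega)] at h
  obtain ⟨k, rfl⟩ := Nat.exists_eq_succ_of_ne_zero h0
  have hp0 : (0 : ℚ) < p := by exact_mod_cast hp.pos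
  unfold hb
  rw [le_div_iff₀ (by exact_mod_cast pow_pos hp.pos _)]
  have h' : ((p ^ k + p ^ (k + 1) : ℕ) : ℚ) ≤ sbu (p ^ (k + 1)) := by exact_mod_cast h
  refine le_trans (le_of_eq ?_) h'
  push_cast
  rw [Nat.succ_eq_add_one, pow_succ]
  field_simp
  ring

theorem hb_lower {p e : ℕ} (hp : p.Prime) (h0 : e ≠ 0) :
    1 + 1 / (p : ℚ) ^ 2 ≤ hb (p ^ e) := by
  by_cases h2 : e = 2
  · subst h2; rw [hb_two_val hp]
  · refine le_trans ?_ (hb_ne_two hp h0 h2)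
    have : (1 : ℚ) < p := by exact_mod_cast hp.one_lt
    have : 1 / (p : ℚ) ^ 2 ≤ 1 / p := by
      apply one_div_le_one_div_of_le (by linarith)
      nlinarith
    linarith

theorem hb_two_big {e : ℕ} (h : 3 ≤ e) : (27 : ℚ) / 16 ≤ hb (2 ^ e) := by
  by_cases h4 : e = 4
  · subst h4
    have := sbu_even Nat.prime_two 2 (by norm_num)
    norm_num [Finset.sum_range_succ] at this
    unfold hb
    norm_num [this]
  · have h := sbu_pow_lower Nat.prime_two (e := e) {e - 2, e - 1, e} (by
      intro i hi; simp only [Finset.mem_insert, Finset.mem_singleton] at hi; omega)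
    rw [Finset.sum_insert (by simp; omega), Finset.sum_pair (by omega)] at h
    obtain ⟨k, rfl⟩ := Nat.exists_eq_add_of_le (show 2 ≤ e by omega)
    have e1 : 2 + k - 2 = k := by omega
    have e2 : 2 + k - 1 = k + 1 := by omega
    rw [e1, e2] at h
    unfold hb
    rw [le_div_iff₀ (by positivity)]
    have h' : ((2 ^ k + (2 ^ (k + 1) + 2 ^ (2 + k)) : ℕ) : ℚ) ≤ sbu (2 ^ (2 + k)) := by
      exact_mod_cast h
    refine le_trans ?_ h'
    push_cast
    have : (0 : ℚ) < 2 ^ k := by positivity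
    have e3 : (2 : ℚ) ^ (2 + k) = 4 * 2 ^ k := by rw [pow_add]; norm_num
    have e4 : (2 : ℚ) ^ (k + 1) = 2 * 2 ^ k := by rw [pow_succ]; ring
    rw [e3, e4]
    linarith

theorem geom_five (k : ℕ) : (∑ i ∈ Finset.range k, 5 ^ i) * 4 + 1 = 5 ^ k := by
  simpa using geom_sum_mul_add (4 : ℕ) k

theorem geom_thirteen (k : ℕ) : (∑ i ∈ Finset.range k, 13 ^ i) * 12 + 1 = 13 ^ k := by
  simpa using geom_sum_mul_add (12 : ℕ) k

theorem geom_two (k : ℕ) : (∑ i ∈ Finset.range k, 2 ^ i) + 1 = 2 ^ k := by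
  simpa using geom_sum_mul_add (1 : ℕ) k

theorem not_dvd_geom {p k : ℕ} (hp : p.Prime) (hk : k ≠ 0) :
    ¬ p ∣ ∑ i ∈ Finset.range k, p ^ i := by
  obtain ⟨j, rfl⟩ := Nat.exists_eq_succ_of_ne_zero hk
  rw [Nat.succ_eq_add_one, Finset.sum_range_succ']
  intro h
  have h1 : p ∣ ∑ i ∈ Finset.range j, p ^ (i + 1) :=
    Finset.dvd_sum fun i _ => dvd_pow_self _ (by omega)
  have := (Nat.dvd_add_right h1).1 h
  rw [pow_zero] at this
  exact hp.one_lt.ne' (Nat.dvd_one.1 this)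

theorem not_dvd_sbu_pow {p e : ℕ} (hp : p.Prime) : ¬ p ∣ sbu (p ^ e) := by
  by_cases he : e = 0
  · subst he
    rw [pow_zero, sbu_one]
    exact fun h => hp.one_lt.ne' (Nat.dvd_one.1 h)
  obtain ⟨k, hk | hk⟩ := Nat.even_or_odd' e
  · subst hk
    rw [sbu_even hp k (by omega)]
    intro h
    rcases hp.dvd_mul.1 h with h | h
    · exact not_dvd_geom hp (by omega) h
    · have := (Nat.dvd_add_right (dvd_pow_self p (show k + 1 ≠ 0 by omega))).1 h
      exact hp.one_lt.ne' (Nat.dvd_one.1 this)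
  · subst hk
    rw [sbu_odd hp k]
    exact not_dvd_geom hp (by omega)

theorem three_primes {n p q r : ℕ} (hn : n ≠ 0) (h8 : ¬ 8 ∣ sbu n)
    (hp : p.Prime ∧ p ≠ 2 ∧ p ∣ n) (hq : q.Prime ∧ q ≠ 2 ∧ q ∣ n) (hr : r.Prime ∧ r ≠ 2 ∧ r ∣ n)
    (h1 : p ≠ q) (h2 : p ≠ r) (h3 : q ≠ r) : False := by
  apply h8
  have := two_pow_card_dvd hn {p, q, r} (by
    intro x hx; simp only [Finset.mem_insert, Finset.mem_singleton] at hx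
    rcases hx with rfl | rfl | rfl <;> assumption)
  rw [Finset.card_eq_three.2 ⟨p, q, r, h1, h2, h3, rfl⟩] at this
  simpa using this

theorem four_primes {n p q r s : ℕ} (hn : n ≠ 0) (h8 : ¬ 16 ∣ sbu n)
    (hp : p.Prime ∧ p ≠ 2 ∧ p ∣ n) (hq : q.Prime ∧ q ≠ 2 ∧ q ∣ n) (hr : r.Prime ∧ r ≠ 2 ∧ r ∣ n)
    (hs : s.Prime ∧ s ≠ 2 ∧ s ∣ n)
    (h1 : p ≠ q) (h2 : p ≠ r) (h3 : q ≠ r) (h4 : s ≠ p) (h5 : s ≠ q) (h6 : s ≠ r) : False := by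
  apply h8
  have := two_pow_card_dvd hn {s, p, q, r} (by
    intro x hx; simp only [Finset.mem_insert, Finset.mem_singleton] at hx
    rcases hx with rfl | rfl | rfl | rfl <;> assumption)
  rw [Finset.card_insert_of_notMem (by simp [h4, h5, h6]),
    Finset.card_eq_three.2 ⟨p, q, r, h1, h2, h3, rfl⟩] at this
  simpa using this

/-- `k` odd: facts about the two factors of `σ**(5^(2k))`. -/
theorem five_coprime {k u w : ℕ} (hk : Odd k) (hu : u.Prime) (hw2 : w ≠ 2)
    (hA : u ∣ ∑ i ∈ Finset.range k, 5 ^ i) (hB : w ∣ 5 ^ (k + 1) + 1) : u ≠ w := by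
  rintro rfl
  have hg := geom_five k
  have h1 : u ∣ 6 := by
    have e : 5 ^ (k + 1) + 1 = (∑ i ∈ Finset.range k, 5 ^ i) * 20 + 6 := by
      rw [pow_succ, ← hg]; ring
    rw [e] at hB
    exact (Nat.dvd_add_right (Dvd.dvd.mul_right hA _)).1 hB
  have h3 : u = 3 := by
    rw [show 6 = 2 * 3 by norm_num] at h1
    rcases hu.dvd_mul.1 h1 with h | h
    · exact absurd ((Nat.prime_dvd_prime_iff_eq hu Nat.prime_two).1 h) hw2
    · exact (Nat.prime_dvd_prime_iff_eq hu Nat.prime_three).1 h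
  subst h3
  obtain ⟨j, rfl⟩ := hk
  have : 5 ^ (2 * j + 1) % 3 = 2 := by
    rw [pow_succ, pow_mul, Nat.mul_mod, Nat.pow_mod]; norm_num
  generalize 5 ^ (2 * j + 1) = z at *
  omega

theorem five_facts {k : ℕ} (hk : Odd k) (hk3 : 3 ≤ k) :
    (∃ u, u.Prime ∧ u ≠ 2 ∧ u ≠ 5 ∧ u ∣ ∑ i ∈ Finset.range k, 5 ^ i) ∧
    (∃ v, v.Prime ∧ v ≠ 2 ∧ v ≠ 5 ∧ v ∣ 5 ^ (k + 1) + 1) := by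
  have hg := geom_five k
  have hbig : 5 ^ 3 ≤ 5 ^ k := Nat.pow_le_pow_right (by norm_num) hk3
  constructor
  · obtain ⟨u, hu, hd⟩ := Nat.exists_prime_and_dvd
      (show (∑ i ∈ Finset.range k, 5 ^ i) ≠ 1 by omega)
    refine ⟨u, hu, ?_, ?_, hd⟩
    · rintro rfl
      obtain ⟨j, rfl⟩ := hk
      have : 5 ^ (2 * j + 1) % 8 = 5 := by
        rw [pow_succ, pow_mul, Nat.mul_mod, Nat.pow_mod]; norm_num
      generalize 5 ^ (2 * j + 1) = z at *
      omega
    · rintro rfl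
      exact not_dvd_geom Nat.prime_five (by omega) hd
  · have h4 : 5 ^ (k + 1) % 4 = 1 := by rw [Nat.pow_mod]; norm_num
    have h5 : 5 ^ (k + 1) = 5 * 5 ^ k := by ring
    obtain ⟨v, hv, hd⟩ := Nat.exists_prime_and_dvd
      (show (5 ^ (k + 1) + 1) / 2 ≠ 1 by omega)
    have hd' : v ∣ 5 ^ (k + 1) + 1 := hd.trans (Nat.div_dvd_of_dvd (by omega))
    refine ⟨v, hv, ?_, ?_, hd'⟩
    · rintro rfl
      omega
    · rintro rfl
      omega

theorem five_form {e : ℕ} (h0 : e ≠ 0) (h2 : e ≠ 2) (h3 : ¬ 3 ∣ sbu (5 ^ e)) :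
    ∃ k, Odd k ∧ 3 ≤ k ∧
      sbu (5 ^ e) = (∑ i ∈ Finset.range k, 5 ^ i) * (5 ^ (k + 1) + 1) := by
  obtain ⟨k, hk | hk⟩ := Nat.even_or_odd' e
  · subst hk
    have hs := sbu_even Nat.prime_five k (by omega)
    refine ⟨k, ?_, ?_, hs⟩
    · by_contra hc
      rw [Nat.not_odd_iff_even] at hc
      apply h3
      rw [hs]
      exact Dvd.dvd.mul_right (Dvd.dvd.trans (by norm_num) (succ_dvd_geom hc)) _
    · by_contra hc
      have : k = 2 := by omega
      subst this
      apply h3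
      rw [hs]
      norm_num [Finset.sum_range_succ]
  · exfalso
    apply h3
    subst hk
    rw [sbu_odd Nat.prime_five k]
    exact Dvd.dvd.trans (by norm_num) (succ_dvd_geom (p := 5) ⟨k + 1, by ring⟩)

theorem sbu_four : sbu (2 ^ 2) = 5 := by
  have := sbu_even Nat.prime_two 1 (by norm_num)
  simpa using this

theorem sbu_25 : sbu (5 ^ 2) = 26 := by
  have := sbu_even Nat.prime_five 1 (by norm_num)
  simpa using this

theorem explicit_form {n : ℕ} (hn : n ≠ 0) (h : ∀ p, p.Prime → p ∣ n → p = 2 ∨ p = 5 ∨ p = 13) :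
    n = 2 ^ n.factorization 2 * (5 ^ n.factorization 5 * 13 ^ n.factorization 13) := by
  have h1 := Nat.prod_factorization_pow_eq_self hn
  rw [Finsupp.prod_of_support_subset (s := {2, 5, 13}) _ (by
    intro p hp
    rw [Nat.support_factorization] at hp
    have := h p (Nat.prime_of_mem_primeFactors hp) (Nat.dvd_of_mem_primeFactors hp)
    simpa using this) _ (by simp)] at h1
  simp at h1
  exact h1.symm

theorem sbu_explicit (a b c : ℕ) :
    sbu (2 ^ a * (5 ^ b * 13 ^ c)) = sbu (2 ^ a) * (sbu (5 ^ b) * sbu (13 ^ c)) := by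
  rw [sbu_mul, sbu_mul]
  · exact Nat.Coprime.pow _ _ (by norm_num)
  · exact Nat.Coprime.mul_right (Nat.Coprime.pow _ _ (by norm_num))
      (Nat.Coprime.pow _ _ (by norm_num))

theorem five_pow_mod (k : ℕ) : 5 ^ k % 17 = 5 ^ (k % 16) % 17 := by
  conv_lhs => rw [← Nat.div_add_mod k 16, pow_add, pow_mul, Nat.mul_mod, Nat.pow_mod]
  norm_num

theorem thirteen_pow_mod (k : ℕ) : 13 ^ k % 5 = 13 ^ (k % 4) % 5 := by
  conv_lhs => rw [← Nat.div_add_mod k 4, pow_add, pow_mul, Nat.mul_mod, Nat.pow_mod]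
  norm_num

theorem not_17_geom {k : ℕ} (hk : Odd k) : ¬ 17 ∣ ∑ i ∈ Finset.range k, 5 ^ i := by
  intro h
  have hg := geom_five k
  have h1 : 5 ^ k % 17 = 1 := by omega
  rw [five_pow_mod] at h1
  obtain ⟨j, rfl⟩ := hk
  have h2 : (2 * j + 1) % 16 < 16 := Nat.mod_lt _ (by norm_num)
  have h3 : (2 * j + 1) % 16 ≠ 0 := by omega
  generalize (2 * j + 1) % 16 = r at *
  interval_cases r <;> simp_all

theorem d11489 {k : ℕ} (h : 17 ∣ 5 ^ (k + 1) + 1) : 11489 ∣ 5 ^ (k + 1) + 1 := by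
  have h1 : 5 ^ (k + 1) % 17 = 16 := by omega
  rw [five_pow_mod] at h1
  have h2 : (k + 1) % 16 = 8 := by
    have h2 : (k + 1) % 16 < 16 := Nat.mod_lt _ (by norm_num)
    generalize (k + 1) % 16 = r at *
    interval_cases r <;> simp_all
  have h3 : k + 1 = 8 * (2 * ((k + 1) / 16) + 1) := by omega
  rw [h3, pow_mul]
  have := Odd.nat_add_dvd_pow_add_pow (5 ^ 8) 1 (n := 2 * ((k + 1) / 16) + 1) ⟨_, rfl⟩
  rw [one_pow] at this
  exact Dvd.dvd.trans (by norm_num) this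

/-- If `5 ∣ σ**(13^s)` then `7` or `17` divides it. -/
theorem thirteen_facts {s : ℕ} (hs : s ≠ 0) (h5 : 5 ∣ sbu (13 ^ s)) :
    7 ∣ sbu (13 ^ s) ∨ 17 ∣ sbu (13 ^ s) := by
  have hp : Nat.Prime 13 := by norm_num
  obtain ⟨l, hl | hl⟩ := Nat.even_or_odd' s
  · subst hl
    rw [sbu_even hp l (by omega)] at h5 ⊢
    rcases Nat.even_or_odd l with he | ho
    · left
      exact Dvd.dvd.mul_right (Dvd.dvd.trans (by norm_num) (succ_dvd_geom he)) _
    · right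
      apply Dvd.dvd.mul_left
      have hg := geom_thirteen l
      rcases Nat.prime_five.dvd_mul.1 h5 with h | h
      · exfalso
        have h1 : 13 ^ l % 5 = 1 := by omega
        rw [thirteen_pow_mod] at h1
        have : l % 4 = 1 ∨ l % 4 = 3 := by
          obtain ⟨j, rfl⟩ := ho; omega
        rcases this with h | h <;> rw [h] at h1 <;> norm_num at h1
      · have h1 : 13 ^ (l + 1) % 5 = 4 := by omega
        rw [thirteen_pow_mod] at h1
        have h2 : (l + 1) % 4 = 2 := by
          have h2 : (l + 1) % 4 < 4 := Nat.mod_lt _ (by norm_num)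
          generalize (l + 1) % 4 = r at *
          interval_cases r <;> simp_all
        have h3 : l + 1 = 2 * (2 * ((l + 1) / 4) + 1) := by omega
        rw [h3, pow_mul]
        have := Odd.nat_add_dvd_pow_add_pow (13 ^ 2) 1 (n := 2 * ((l + 1) / 4) + 1) ⟨_, rfl⟩
        rw [one_pow] at this
        exact Dvd.dvd.trans (by norm_num) this
  · left
    subst hl
    rw [sbu_odd hp l]
    exact Dvd.dvd.trans (by norm_num) (succ_dvd_geom (p := 13) ⟨l + 1, by ring⟩)

/-- The case of a power of two. -/
theorem pow_two_case {e : ℕ} (he : e ≠ 0) (h : sbu (sbu (2 ^ e)) = 2 * 2 ^ e) : e = 1 := by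
  obtain ⟨k, hk | hk⟩ := Nat.even_or_odd' e
  · exfalso
    have hk0 : k ≠ 0 := by omega
    subst hk
    rw [sbu_even Nat.prime_two k hk0] at h
    have hg := geom_two k
    obtain ⟨A, hA⟩ : ∃ A, A = ∑ i ∈ Finset.range k, 2 ^ i := ⟨_, rfl⟩
    rw [← hA] at h hg
    have hB : 2 ^ (k + 1) + 1 = 2 * A + 3 := by rw [pow_succ, ← hg]; ring
    have hR : 2 * 2 ^ (2 * k) = 2 * (A + 1) ^ 2 := by rw [hg, ← pow_mul, mul_comm k 2]
    rcases Nat.even_or_odd k with hev | hod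
    · have h3A : 3 ∣ A := by
        rw [hA]; exact succ_dvd_geom hev
      have hA3 : 3 ≤ A := by
        have : 2 ^ 2 ≤ 2 ^ k := Nat.pow_le_pow_right (by norm_num) (by
          obtain ⟨j, rfl⟩ := hev; omega)
        omega
      set M := A * (2 ^ (k + 1) + 1) with hM
      have hM' : M = A * (2 * A + 3) := by rw [hM, hB]
      have h9 : 3 ^ 2 ∣ M := by
        rw [hM']
        exact mul_dvd_mul h3A (by omega)
      have hM0 : M ≠ 0 := by rw [hM']; positivity
      have hv := (Nat.prime_three.pow_dvd_iff_le_factorization hM0).1 h9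
      by_cases h2 : M.factorization 3 = 2
      · have := sbu_pow_dvd (p := 3) hM0
        rw [h2, h] at this
        have e9 := sbu_even Nat.prime_three 1 (by norm_num)
        norm_num at e9
        norm_num at this
        rw [e9] at this
        have h5 : 5 ∣ 2 * 2 ^ (2 * k) := Dvd.dvd.trans (by norm_num) this
        rw [← pow_succ'] at h5
        have := Nat.prime_five.dvd_of_dvd_pow h5
        norm_num at this
      · have h1 := hb_prod_le hM0 {3} (by simp [Nat.prime_three])
        have h4 := hb_ne_two Nat.prime_three (e := M.factorization 3) (by omega) h2
        rw [Finset.prod_singleton] at h1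
        have h5 := h4.trans h1
        unfold hb at h5
        rw [h, le_div_iff₀ (by positivity), hR, hM'] at h5
        push_cast at h5
        have hA3' : (3 : ℚ) ≤ A := by exact_mod_cast hA3
        nlinarith
    · have hcop : Nat.Coprime A (2 ^ (k + 1) + 1) := by
        rw [hB]
        have h3 : ¬ 3 ∣ A := by
          obtain ⟨j, rfl⟩ := hod
          have : 2 ^ (2 * j + 1) % 3 = 2 := by
            rw [pow_succ, pow_mul, Nat.mul_mod, Nat.pow_mod]; norm_num
          generalize 2 ^ (2 * j + 1) = z at *
          omega
        have : Nat.Coprime A 3 := ((Nat.Prime.coprime_iff_not_dvd Nat.prime_three).2 h3).symm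
        rw [add_comm]
        exact (Nat.coprime_add_mul_right_right A 3 2).2 this
      rw [sbu_mul _ _ hcop, hR, hB] at h
      have b2 := succ_le_sbu (n := 2 * A + 3) (by omega)
      by_cases h1 : A = 1
      · subst h1
        rw [sbu_one] at h
        have := sbu_odd Nat.prime_five 0
        norm_num [Finset.sum_range_succ] at this h
        omega
      · have hA1 : 1 < A := by
          rcases Nat.eq_zero_or_pos A with h0 | h0
          · have : 2 ^ 1 ≤ 2 ^ k := Nat.pow_le_pow_right (by norm_num) (by omega)
            omega
          · omega
        have b1 := succ_le_sbu hA1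
        have := Nat.mul_le_mul b1 b2
        nlinarith
  · by_contra hne
    subst hk
    rw [sbu_odd Nat.prime_two k] at h
    have hg := geom_two (2 * k + 2)
    have hx : 2 ^ 2 ≤ 2 ^ (k + 1) := Nat.pow_le_pow_right (by norm_num) (by omega)
    obtain ⟨y, hy⟩ : ∃ y, 2 ^ (k + 1) = y + 1 := ⟨2 ^ (k + 1) - 1, by omega⟩
    have e1 : 2 ^ (2 * k + 2) = (y + 1) ^ 2 := by rw [← hy, ← pow_mul]; ring
    have e2 : ∑ i ∈ Finset.range (2 * k + 2), 2 ^ i = y * (y + 2) := by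
      have : (y + 1) ^ 2 = y * (y + 2) + 1 := by ring
      omega
    have hyo : ¬ 2 ∣ y := by
      have : 2 ^ (k + 1) = 2 * 2 ^ k := by ring
      omega
    have hcop : Nat.Coprime y (y + 2) := by
      rw [Nat.coprime_self_add_right]
      exact ((Nat.Prime.coprime_iff_not_dvd Nat.prime_two).2 hyo).symm
    rw [e2, sbu_mul _ _ hcop, ← pow_succ', e1] at h
    have := Nat.mul_le_mul (succ_le_sbu (n := y) (by omega)) (succ_le_sbu (n := y + 2) (by omega))
    nlinarith

/-- The case where both `N` and `σ**(N)` are exactly divisible by `4`. -/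
theorem case_two_two {N M : ℕ} (hN : N ≠ 0) (hM : M ≠ 0) (hNM : sbu N = M) (hMN : sbu M = 2 * N)
    (e2 : N.factorization 2 = 2) (f2 : M.factorization 2 = 2)
    (hprod : ∀ S : Finset ℕ, (∀ p ∈ S, p.Prime) →
      (∏ p ∈ S, hb (p ^ N.factorization p)) * (∏ p ∈ S, hb (p ^ M.factorization p)) ≤ 2) :
    False := by
  have p13 : Nat.Prime 13 := by norm_num
  have p7 : Nat.Prime 7 := by norm_num
  have p17 : Nat.Prime 17 := by norm_num
  have odd_dvd : ∀ p, p.Prime → p ≠ 2 → p ∣ 2 * N → p ∣ N := by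
    intro p hp h2 hd
    rcases hp.dvd_mul.1 hd with h | h
    · exact absurd ((Nat.prime_dvd_prime_iff_eq hp Nat.prime_two).1 h) h2
    · exact h
  have h8M : ¬ 8 ∣ sbu N := by
    rw [hNM]
    intro h
    have := (Nat.prime_two.pow_dvd_iff_le_factorization (k := 3) hM).1 (by simpa using h)
    omega
  have h16 : ¬ 16 ∣ sbu M := by
    rw [hMN]
    intro h
    have := (Nat.prime_two.pow_dvd_iff_le_factorization (k := 3) hN).1 (by
      norm_num; omega)
    omega
  have h5M : 5 ∣ M := by
    have := sbu_pow_dvd (p := 2) hN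
    rwa [e2, sbu_four, hNM] at this
  have h5N : 5 ∣ N := by
    have := sbu_pow_dvd (p := 2) hM
    rw [f2, sbu_four, hMN] at this
    exact odd_dvd 5 Nat.prime_five (by norm_num) this
  have ha0 := (Nat.prime_five.factorization_pos_of_dvd hN h5N).ne'
  have hc0 := (Nat.prime_five.factorization_pos_of_dvd hM h5M).ne'
  have t4 : hb (2 ^ 2) = 5 / 4 := by rw [hb_two_val Nat.prime_two]; norm_num
  have t25 : hb (5 ^ 2) = 26 / 25 := by rw [hb_two_val Nat.prime_five]; norm_num
  have lowpos : ∀ n p : ℕ, p.Prime → 1 ≤ hb (p ^ n.factorization p) :=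
    fun n p hp => one_le_hb (pow_pos hp.pos _)
  have low3 : ∀ n : ℕ, n ≠ 0 → 3 ∣ n → (10 : ℚ) / 9 ≤ hb (3 ^ n.factorization 3) := by
    intro n hn hd
    have := hb_lower Nat.prime_three (Nat.prime_three.factorization_pos_of_dvd hn hd).ne'
    norm_num at this ⊢; linarith
  have low5 : ∀ n : ℕ, n.factorization 5 ≠ 0 → n.factorization 5 ≠ 2 →
      (6 : ℚ) / 5 ≤ hb (5 ^ n.factorization 5) := by
    intro n h1 h2
    have := hb_ne_two Nat.prime_five h1 h2
    norm_num at this ⊢; linarith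
  -- if exactly one of the two exponents of 5 is 2 then 3 does not divide N, M
  have hP3 := hprod {2, 3, 5} (by
    intro p hp; simp only [Finset.mem_insert, Finset.mem_singleton] at hp
    rcases hp with rfl | rfl | rfl <;> norm_num)
  simp only [Finset.prod_insert (show 2 ∉ ({3, 5} : Finset ℕ) by decide),
    Finset.prod_pair (show (3 : ℕ) ≠ 5 by decide), e2, f2, t4] at hP3
  have n3 := lowpos N 3 Nat.prime_three
  have m3 := lowpos M 3 Nat.prime_three
  have bound3 : ∀ x y u v : ℚ, 1 ≤ x → 1 ≤ y → 0 < u → 0 < v →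
      5 / 4 * (x * u) * (5 / 4 * (y * v)) ≤ 2 → x * y * (u * v) ≤ 32 / 25 := by
    intro x y u v _ _ _ _ h
    nlinarith
  have hub : ∀ n, 0 < hb (5 ^ n) := fun n =>
    lt_of_lt_of_le one_pos (one_le_hb (pow_pos (by norm_num) _))
  have B3 := bound3 _ _ _ _ n3 m3 (hub _) (hub _) hP3
  have no3 : (26 : ℚ) / 25 * (6 / 5) ≤ hb (5 ^ N.factorization 5) * hb (5 ^ M.factorization 5) →
      ¬ 3 ∣ N ∧ ¬ 3 ∣ M := by
    intro h
    have key : (10 : ℚ) / 9 ≤ hb (3 ^ N.factorization 3) * hb (3 ^ M.factorization 3) → False := by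
      intro h'
      have := mul_le_mul h' h (by norm_num) (by positivity)
      have := this.trans B3
      norm_num at this
    constructor
    · intro hd
      have := low3 N hN hd
      exact key (by nlinarith)
    · intro hd
      have := low3 M hM hd
      exact key (by nlinarith)
  by_cases ha : N.factorization 5 = 2
  · have h26 : 26 ∣ M := by
      have := sbu_pow_dvd (p := 5) hN
      rwa [ha, sbu_25, hNM] at this
    by_cases hc : M.factorization 5 = 2
    · have h13 : 13 ∣ N := by
        have := sbu_pow_dvd (p := 5) hM
        rw [hc, sbu_25, hMN] at this
        omega
      have hprimes : ∀ p, p.Prime → p ∣ N → p = 2 ∨ p = 5 ∨ p = 13 := by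
        intro p hp hd
        by_contra hcon
        push Not at hcon
        exact three_primes hN h8M ⟨hp, hcon.1, hd⟩ ⟨Nat.prime_five, by norm_num, h5N⟩
          ⟨p13, by norm_num, h13⟩ hcon.2.1 hcon.2.2 (by norm_num)
      have hex := explicit_form hN hprimes
      have hMe : M = 5 * (26 * sbu (13 ^ N.factorization 13)) := by
        rw [← hNM]
        conv_lhs => rw [hex]
        rw [sbu_explicit, e2, ha, sbu_four, sbu_25]
      have hnd := not_dvd_sbu_pow (e := N.factorization 13) p13
      have hd1 : M.factorization 13 = 1 := by
        have h1 : 1 ≤ M.factorization 13 :=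
          p13.factorization_pos_of_dvd hM (by omega)
        by_contra hcon
        have := (p13.pow_dvd_iff_le_factorization (k := 2) hM).2 (by omega)
        norm_num at this
        omega
      have h14 := sbu_pow_dvd (p := 13) hM
      have s13 := sbu_odd p13 0
      norm_num [Finset.sum_range_succ] at s13
      rw [hd1, pow_one, s13, hMN] at h14
      have := hprimes 7 p7 (by omega)
      omega
    · have hb5 := low5 M hc0 hc
      have h3N := (no3 (by
        rw [ha, t25]
        linarith)).1
      have hdvd := sbu_pow_dvd (p := 5) hM
      rw [hMN] at hdvd
      obtain ⟨k, hk, hk3, hs⟩ := five_form hc0 hc (fun h =>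
        h3N (odd_dvd 3 Nat.prime_three (by norm_num) (h.trans hdvd)))
      obtain ⟨⟨u, hu, hu2, hu5, hud⟩, ⟨v, hv, hv2, hv5, hvd⟩⟩ := five_facts hk hk3
      have huv := five_coprime hk hu hv2 hud hvd
      rw [hs] at hdvd
      exact three_primes hN h8M ⟨hu, hu2, odd_dvd u hu hu2 ((hud.mul_right _).trans hdvd)⟩
        ⟨hv, hv2, odd_dvd v hv hv2 ((hvd.mul_left _).trans hdvd)⟩
        ⟨Nat.prime_five, by norm_num, h5N⟩ huv hu5 hv5
  · have hb5 := low5 N ha0 ha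
    by_cases hc : M.factorization 5 = 2
    · have hno := no3 (by
        rw [hc, t25]
        linarith)
      have h13 : 13 ∣ N := by
        have := sbu_pow_dvd (p := 5) hM
        rw [hc, sbu_25, hMN] at this
        omega
      have hprimes : ∀ p, p.Prime → p ∣ N → p = 2 ∨ p = 5 ∨ p = 13 := by
        intro p hp hd
        by_contra hcon
        push Not at hcon
        exact three_primes hN h8M ⟨hp, hcon.1, hd⟩ ⟨Nat.prime_five, by norm_num, h5N⟩
          ⟨p13, by norm_num, h13⟩ hcon.2.1 hcon.2.2 (by norm_num)
      have hex := explicit_form hN hprimes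
      have hMe : M = 5 * (sbu (5 ^ N.factorization 5) * sbu (13 ^ N.factorization 13)) := by
        rw [← hNM]
        conv_lhs => rw [hex]
        rw [sbu_explicit, e2, sbu_four]
      have hdvd := sbu_pow_dvd (p := 5) hN
      rw [hNM] at hdvd
      have hs0 := (p13.factorization_pos_of_dvd hN h13).ne'
      have h5s : 5 ∣ sbu (13 ^ N.factorization 13) := by
        have h25 := (Nat.prime_five.pow_dvd_iff_le_factorization (k := 2) hM).2 hc.ge
        have : 5 ∣ sbu (5 ^ N.factorization 5) * sbu (13 ^ N.factorization 13) := by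
          rw [hMe] at h25
          norm_num at h25
          omega
        exact (Nat.prime_five.dvd_mul.1 this).resolve_left (not_dvd_sbu_pow Nat.prime_five)
      have h13M : sbu (13 ^ N.factorization 13) ∣ M := by
        have := sbu_pow_dvd (p := 13) hN
        rwa [hNM] at this
      rcases thirteen_facts hs0 h5s with h7 | h17
      · -- abundancy
        have h7M := h7.trans h13M
        have l7 := hb_lower p7 (p7.factorization_pos_of_dvd hM h7M).ne'
        have l13 := hb_lower p13 hs0
        have hP := hprod {2, 5, 7, 13} (by
          intro p hp; simp only [Finset.mem_insert, Finset.mem_singleton] at hp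
          rcases hp with rfl | rfl | rfl | rfl <;> norm_num)
        simp only [Finset.prod_insert (show 2 ∉ ({5, 7, 13} : Finset ℕ) by decide),
          Finset.prod_insert (show 5 ∉ ({7, 13} : Finset ℕ) by decide),
          Finset.prod_pair (show (7 : ℕ) ≠ 13 by decide), e2, f2, hc, t4, t25] at hP
        have n7 := lowpos N 7 p7
        have m13 := lowpos M 13 p13
        norm_num at l7 l13
        have b1 : (5 : ℚ) / 4 * (6 / 5 * (1 * (170 / 169))) ≤
            5 / 4 * (hb (5 ^ N.factorization 5) *
              (hb (7 ^ N.factorization 7) * hb (13 ^ N.factorization 13))) := by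
          gcongr
        have b2 : (5 : ℚ) / 4 * (26 / 25 * (50 / 49 * 1)) ≤
            5 / 4 * (26 / 25 *
              (hb (7 ^ M.factorization 7) * hb (13 ^ M.factorization 13))) := by
          gcongr
        have := (mul_le_mul b1 b2 (by norm_num) (le_trans (by norm_num) b1)).trans hP
        norm_num at this
      · have h17M := h17.trans h13M
        obtain ⟨k, hk, hk3, hs⟩ := five_form ha0 ha (fun h => hno.2 (h.trans hdvd))
        obtain ⟨⟨u, hu, hu2, hu5, hud⟩, ⟨v, hv, hv2, hv5, hvd⟩⟩ := five_facts hk hk3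
        have hu17 : u ≠ 17 := by
          rintro rfl
          exact not_17_geom hk hud
        obtain ⟨w, hw, hw2, hw5, hw17, hwd⟩ : ∃ w, w.Prime ∧ w ≠ 2 ∧ w ≠ 5 ∧ w ≠ 17 ∧
            w ∣ 5 ^ (k + 1) + 1 := by
          by_cases hv17 : v = 17
          · subst hv17
            exact ⟨11489, by norm_num, by norm_num, by norm_num, by norm_num, d11489 hvd⟩
          · exact ⟨v, hv, hv2, hv5, hv17, hvd⟩
        have huw := five_coprime hk hu hw2 hud hwd
        rw [hs] at hdvd
        exact four_primes hM h16 ⟨hu, hu2, (hud.mul_right _).trans hdvd⟩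
          ⟨hw, hw2, (hwd.mul_left _).trans hdvd⟩ ⟨Nat.prime_five, by norm_num, h5M⟩
          ⟨p17, by norm_num, h17M⟩ huw hu5 hw5 hu17.symm hw17.symm (by norm_num)
    · have hb5' := low5 M hc0 hc
      have h1 := mul_le_mul hb5 hb5' (by norm_num) (by linarith)
      have h2 := mul_le_mul n3 m3 (by norm_num) (by linarith)
      have h3 := mul_le_mul h2 h1 (by norm_num) (by linarith)
      have := h3.trans B3
      norm_num at this

theorem stmt17 (N : ℕ) (hN : 0 < N) (heven : Even N) :
    sbu (sbu N) = 2 * N ↔ N = 2 := by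
  constructor
  · intro h
    have hN0 : N ≠ 0 := hN.ne'
    obtain ⟨M, hNM⟩ : ∃ M, sbu N = M := ⟨_, rfl⟩
    have hMN : sbu M = 2 * N := by rw [← hNM]; exact h
    have hM : M ≠ 0 := by rw [← hNM]; exact (sbu_pos hN).ne'
    have he0 := (Nat.prime_two.factorization_pos_of_dvd hN0 heven.two_dvd).ne'
    by_cases hpow : ∃ p, p.Prime ∧ p ≠ 2 ∧ p ∣ N
    · exfalso
      obtain ⟨p, hp, hp2, hpd⟩ := hpow
      have h2M : 2 ∣ M := by
        have := two_pow_card_dvd hN0 {p} (by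
          intro q hq
          rw [Finset.mem_singleton] at hq
          subst hq
          exact ⟨hp, hp2, hpd⟩)
        rw [hNM] at this
        simpa using this
      have hf0 := (Nat.prime_two.factorization_pos_of_dvd hM h2M).ne'
      have hhb : hb N * hb M = 2 := by
        unfold hb
        rw [hNM, hMN]
        have : (N : ℚ) ≠ 0 := by exact_mod_cast hN0
        have : (M : ℚ) ≠ 0 := by exact_mod_cast hM
        push_cast
        field_simp
      have hprod : ∀ S : Finset ℕ, (∀ p ∈ S, p.Prime) →
          (∏ p ∈ S, hb (p ^ N.factorization p)) * (∏ p ∈ S, hb (p ^ M.factorization p)) ≤ 2 := by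
        intro S hS
        rw [← hhb]
        refine mul_le_mul (hb_prod_le hN0 S hS) (hb_prod_le hM S hS) ?_ ?_
        · exact Finset.prod_nonneg fun p hp =>
            zero_le_one.trans (one_le_hb (pow_pos (hS p hp).pos _))
        · exact zero_le_one.trans (one_le_hb hN)
      have hP2 := hprod {2} (by simp [Nat.prime_two])
      have hP23 := hprod {2, 3} (by simp [Nat.prime_two, Nat.prime_three])
      simp only [Finset.prod_singleton] at hP2
      simp only [Finset.prod_pair (show (2 : ℕ) ≠ 3 by decide)] at hP23
      have t4 : hb (2 ^ 2) = 5 / 4 := by rw [hb_two_val Nat.prime_two]; norm_num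
      have s2 : sbu (2 ^ 1) = 3 := by
        have := sbu_odd Nat.prime_two 0
        norm_num [Finset.sum_range_succ] at this ⊢
        exact this
      have t2 : hb (2 ^ 1) = 3 / 2 := by
        unfold hb
        rw [s2]; norm_num
      have low3 : ∀ n : ℕ, n ≠ 0 → 3 ∣ n → (10 : ℚ) / 9 ≤ hb (3 ^ n.factorization 3) := by
        intro n hn hd
        have := hb_lower Nat.prime_three (Nat.prime_three.factorization_pos_of_dvd hn hd).ne'
        norm_num at this ⊢; linarith
      have ge1 : ∀ n : ℕ, 1 ≤ hb (3 ^ n) := fun n => one_le_hb (pow_pos (by norm_num) _)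
      have low2 : ∀ e : ℕ, e ≠ 0 → e ≠ 2 → (3 : ℚ) / 2 ≤ hb (2 ^ e) := by
        intro e h1 h2
        have := hb_ne_two Nat.prime_two h1 h2
        norm_num at this ⊢; linarith
      by_cases he2 : N.factorization 2 = 2
      · by_cases hf2 : M.factorization 2 = 2
        · exact case_two_two hN0 hM hNM hMN he2 hf2 hprod
        · rw [he2, t4] at hP2 hP23
          by_cases hf1 : M.factorization 2 = 1
          · have h3 : 3 ∣ N := by
              have := sbu_pow_dvd (p := 2) hM
              rw [hf1, s2, hMN] at this
              omega
            have l3 := low3 N hN0 h3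
            have l3' := ge1 (M.factorization 3)
            rw [hf1, t2] at hP23
            nlinarith
          · have := hb_two_big (e := M.factorization 2) (by omega)
            linarith
      · by_cases hf2 : M.factorization 2 = 2
        · rw [hf2, t4] at hP2 hP23
          by_cases he1 : N.factorization 2 = 1
          · have h3 : 3 ∣ M := by
              have := sbu_pow_dvd (p := 2) hN0
              rwa [he1, s2, hNM] at this
            have l3 := low3 M hM h3
            have l3' := ge1 (N.factorization 3)
            rw [he1, t2] at hP23
            nlinarith
          · have := hb_two_big (e := N.factorization 2) (by omega)
            linarith
        · have h1 := low2 _ he0 he2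
          have h2 := low2 _ hf0 hf2
          nlinarith
    · push Not at hpow
      have hN2 : N = 2 ^ N.factorization 2 := by
        have h1 := Nat.prod_factorization_pow_eq_self hN0
        rw [Finsupp.prod_of_support_subset (s := {2}) _ (by
          intro p hp
          rw [Nat.support_factorization] at hp
          by_contra hcon
          exact hpow p (Nat.prime_of_mem_primeFactors hp) (by simpa using hcon)
            (Nat.dvd_of_mem_primeFactors hp)) _ (by simp)] at h1
        simpa using h1.symm
      have h' := h
      rw [hN2] at h'
      have := pow_two_case he0 h'
      rw [hN2, this, pow_one]
  · rintro rfl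
    have s2 : sbu 2 = 3 := by
      have := sbu_odd Nat.prime_two 0
      norm_num [Finset.sum_range_succ] at this
      exact this
    have s3 : sbu 3 = 4 := by
      have := sbu_odd Nat.prime_three 0
      norm_num [Finset.sum_range_succ] at this
      exact this
    rw [s2, s3]
end

section
/- The only odd positive integer N satisfying σ**(σ**(N)) = 2N is N = 9. -/
namespace BU

lemma unitary_iff {c n : ℕ} (hn : 0 < n) :
    IsUnitaryDivisor c n ↔ ∃ k, n = c * k ∧ Nat.Coprime c k := by
  constructor
  · rintro ⟨⟨k, rfl⟩, h⟩
    refine ⟨k, rfl, ?_⟩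
    have hc : 0 < c := Nat.pos_of_mul_pos_right hn |> fun h => by
      rcases Nat.eq_zero_or_pos c with h0 | h0
      · simp [h0] at hn
      · exact h0
    rwa [Nat.mul_div_cancel_left _ hc] at h
  · rintro ⟨k, rfl, h⟩
    have hc : 0 < c := by
      rcases Nat.eq_zero_or_pos c with h0 | h0
      · simp [h0] at hn
      · exact h0
    refine ⟨dvd_mul_right _ _, ?_⟩
    rwa [Nat.mul_div_cancel_left _ hc]

lemma unitary_gcd {c x y : ℕ} (hx : 0 < x) (hy : 0 < y) (h : IsUnitaryDivisor c (x * y)) :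
    IsUnitaryDivisor (Nat.gcd x c) x := by
  rw [unitary_iff (by positivity)] at h
  obtain ⟨k, hk, hc⟩ := h
  rw [unitary_iff hx]
  refine ⟨Nat.gcd x k, ?_, ?_⟩
  · rw [← Nat.Coprime.gcd_mul x hc, ← hk]
    simp
  · exact Nat.Coprime.coprime_dvd_left (Nat.gcd_dvd_right _ _)
      (Nat.Coprime.coprime_dvd_right (Nat.gcd_dvd_right _ _) hc)

lemma unitary_mul {c x y : ℕ} (hx : 0 < x) (hy : 0 < y) (hxy : Nat.Coprime x y)
    (h : IsUnitaryDivisor c x) : IsUnitaryDivisor c (x * y) := by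
  rw [unitary_iff hx] at h
  obtain ⟨k, rfl, hc⟩ := h
  rw [unitary_iff (by positivity)]
  refine ⟨k * y, by ring, ?_⟩
  exact Nat.Coprime.mul_right hc (Nat.Coprime.coprime_dvd_left (dvd_mul_right _ _) hxy)

lemma biunitary_mul {m n a b : ℕ} (hm : 0 < m) (hn : 0 < n) (hmn : Nat.Coprime m n)
    (ha : a ∣ m) (hb : b ∣ n) :
    IsBiunitaryDivisor (a * b) (m * n) ↔ IsBiunitaryDivisor a m ∧ IsBiunitaryDivisor b n := by
  obtain ⟨a', rfl⟩ := ha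
  obtain ⟨b', rfl⟩ := hb
  have ha0 : 0 < a := Nat.pos_of_ne_zero (by rintro rfl; simp at hm)
  have hb0 : 0 < b := Nat.pos_of_ne_zero (by rintro rfl; simp at hn)
  have ha0' : 0 < a' := Nat.pos_of_ne_zero (by rintro rfl; simp at hm)
  have hb0' : 0 < b' := Nat.pos_of_ne_zero (by rintro rfl; simp at hn)
  have hab : Nat.Coprime a b := Nat.Coprime.coprime_dvd_left (dvd_mul_right a a')
      (Nat.Coprime.coprime_dvd_right (dvd_mul_right b b') hmn)
  have hab' : Nat.Coprime a' b' := Nat.Coprime.coprime_dvd_left (dvd_mul_left a' a)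
      (Nat.Coprime.coprime_dvd_right (dvd_mul_left b' b) hmn)
  have e : a * a' * (b * b') = a * b * (a' * b') := by ring
  unfold IsBiunitaryDivisor
  rw [e, Nat.mul_div_cancel_left _ (by positivity), Nat.mul_div_cancel_left _ ha0,
    Nat.mul_div_cancel_left _ hb0]
  constructor
  · rintro ⟨-, h⟩
    refine ⟨⟨dvd_mul_right _ _, fun c h1 h2 => h c (unitary_mul ha0 hb0 hab h1)
      (unitary_mul ha0' hb0' hab' h2)⟩, ⟨dvd_mul_right _ _, fun c h1 h2 => h c ?_ ?_⟩⟩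
    · rw [mul_comm]; exact unitary_mul hb0 ha0 hab.symm h1
    · rw [mul_comm]; exact unitary_mul hb0' ha0' hab'.symm h2
  · rintro ⟨⟨-, h1⟩, ⟨-, h2⟩⟩
    refine ⟨dvd_mul_right _ _, fun c hc hc' => ?_⟩
    have key : ∀ x y x' y' : ℕ, 0 < x → 0 < y → 0 < x' → 0 < y' → Nat.Coprime x y' →
        Nat.Coprime x' y → IsUnitaryDivisor c (x * y) → IsUnitaryDivisor c (x' * y') →
        Nat.gcd x c = Nat.gcd x' c := by
      intro x y x' y' _ _ _ _ c1 c2 u v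
      apply Nat.dvd_antisymm
      · apply Nat.dvd_gcd _ (Nat.gcd_dvd_right _ _)
        have : Nat.gcd x c ∣ x' * y' := (Nat.gcd_dvd_right _ _).trans v.1
        exact Nat.Coprime.dvd_of_dvd_mul_right
          (Nat.Coprime.coprime_dvd_left (Nat.gcd_dvd_left _ _) c1) this
      · apply Nat.dvd_gcd _ (Nat.gcd_dvd_right _ _)
        have : Nat.gcd x' c ∣ x * y := (Nat.gcd_dvd_right _ _).trans u.1
        exact Nat.Coprime.dvd_of_dvd_mul_right
          (Nat.Coprime.coprime_dvd_left (Nat.gcd_dvd_left _ _) c2) this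
    have cab' : Nat.Coprime a b' := Nat.Coprime.coprime_dvd_left (dvd_mul_right a a')
      (Nat.Coprime.coprime_dvd_right (dvd_mul_left b' b) hmn)
    have ca'b : Nat.Coprime a' b := Nat.Coprime.coprime_dvd_left (dvd_mul_left a' a)
      (Nat.Coprime.coprime_dvd_right (dvd_mul_right b b') hmn)
    have g1 : Nat.gcd a c = 1 := by
      apply h1 _ (unitary_gcd ha0 hb0 hc)
      rw [key a b a' b' ha0 hb0 ha0' hb0' cab' ca'b hc hc']
      exact unitary_gcd ha0' hb0' hc'
    have hc2 : IsUnitaryDivisor c (b * a) := by rwa [mul_comm]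
    have hc2' : IsUnitaryDivisor c (b' * a') := by rwa [mul_comm]
    have g2 : Nat.gcd b c = 1 := by
      apply h2 _ (unitary_gcd hb0 ha0 hc2)
      rw [key b a b' a' hb0 ha0 hb0' ha0' ca'b.symm cab'.symm hc2 hc2']
      exact unitary_gcd hb0' ha0' hc2'
    have : Nat.Coprime (a * b) c := Nat.Coprime.mul_left g1 g2
    exact Nat.Coprime.eq_one_of_dvd this.symm hc.1

open scoped Classical in
lemma sbu_eq (n : ℕ) : sbu n = ∑ d ∈ n.divisors, if IsBiunitaryDivisor d n then d else 0 := by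
  rw [sbu, Finset.sum_filter]

lemma sbu_mul {m n : ℕ} (hm : 0 < m) (hn : 0 < n) (hmn : Nat.Coprime m n) :
    sbu (m * n) = sbu m * sbu n := by
  classical
  rw [sbu_eq, sbu_eq, sbu_eq, Nat.divisors_mul, Finset.mul_def, Finset.sum_image
    (by simpa using hmn.mul_injOn_divisors), Finset.sum_mul_sum, Finset.sum_product]
  apply Finset.sum_congr rfl
  intro a ha
  apply Finset.sum_congr rfl
  intro b hb
  have := biunitary_mul hm hn hmn (Nat.dvd_of_mem_divisors ha) (Nat.dvd_of_mem_divisors hb)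
  by_cases h1 : IsBiunitaryDivisor a m <;> by_cases h2 : IsBiunitaryDivisor b n <;>
    simp [this, h1, h2]

lemma biunitary_pp {p : ℕ} (hp : p.Prime) {e i : ℕ} (he : 0 < e) (hi : i ≤ e) :
    IsBiunitaryDivisor (p ^ i) (p ^ e) ↔ 2 * i ≠ e := by
  have hp0 := hp.pos
  unfold IsBiunitaryDivisor
  rw [Nat.pow_div hi hp0]
  constructor
  · rintro ⟨-, h⟩ h2
    have h3 : e - i = i := by omega
    rw [h3] at h
    have hu : IsUnitaryDivisor (p ^ i) (p ^ i) :=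
      (unitary_iff (by positivity)).2 ⟨1, by simp, by simp⟩
    have := h _ hu hu
    have hi0 : 0 < i := by omega
    have := Nat.one_lt_pow hi0.ne' hp.one_lt
    omega
  · intro h2
    have key : ∀ j c, IsUnitaryDivisor c (p ^ j) → c = 1 ∨ c = p ^ j := by
      intro j c hc
      rw [unitary_iff (by positivity)] at hc
      obtain ⟨k, hk, hc⟩ := hc
      obtain ⟨x, -, rfl⟩ := (Nat.dvd_prime_pow hp).1 (Dvd.intro _ hk.symm)
      obtain ⟨y, -, rfl⟩ := (Nat.dvd_prime_pow hp).1 (Dvd.intro_left _ hk.symm)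
      rcases Nat.eq_zero_or_pos x with rfl | hx
      · left; simp
      · rcases Nat.eq_zero_or_pos y with rfl | hy
        · right; simp [hk]
        · exfalso
          rw [Nat.coprime_pow_left_iff hx, Nat.coprime_pow_right_iff hy] at hc
          simp at hc
          exact hp.one_lt.ne' hc
    refine ⟨pow_dvd_pow _ hi, fun c h h' => ?_⟩
    rcases key _ _ h with h | h
    · exact h
    rcases key _ _ h' with h' | h'
    · exact h'
    have := Nat.pow_right_injective hp.two_le (h.symm.trans h')
    omega

lemma sbu_pp {p : ℕ} (hp : p.Prime) {e : ℕ} (he : 0 < e) :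
    sbu (p ^ e) = ∑ i ∈ Finset.range (e + 1), if 2 * i ≠ e then p ^ i else 0 := by
  classical
  rw [sbu_eq, Nat.sum_divisors_prime_pow hp]
  apply Finset.sum_congr rfl
  intro i hi
  have hi : i ≤ e := by simp at hi; omega
  simp only [biunitary_pp hp he hi]

/-- geometric sum -/
def G (p m : ℕ) : ℕ := ∑ i ∈ Finset.range m, p ^ i

lemma sum_split (p m n : ℕ) : ∑ i ∈ Finset.range (m + n), p ^ i = G p m + p ^ m * G p n := by
  rw [G, G, Finset.sum_range_add, Finset.mul_sum]
  simp [pow_add]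

lemma sbu_odd_pow {p : ℕ} (hp : p.Prime) (m : ℕ) :
    sbu (p ^ (2 * m + 1)) = G p (m + 1) * (p ^ (m + 1) + 1) := by
  rw [sbu_pp hp (by omega)]
  rw [show 2 * m + 1 + 1 = (m + 1) + (m + 1) by ring]
  rw [Finset.sum_congr rfl (g := fun i => p ^ i), sum_split]
  · ring
  · intro i _
    rw [if_pos (by omega)]

lemma sbu_even_pow {p : ℕ} (hp : p.Prime) {m : ℕ} (hm : 0 < m) :
    sbu (p ^ (2 * m)) = G p m * (p ^ (m + 1) + 1) := by
  rw [sbu_pp hp (by omega)]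
  rw [show 2 * m + 1 = (m + 1) + m by ring, Finset.sum_range_add, Finset.sum_range_succ]
  rw [if_neg (by simp)]
  have h1 : ∑ x ∈ Finset.range m, (if 2 * x ≠ 2 * m then p ^ x else 0) = G p m := by
    apply Finset.sum_congr rfl
    intro i hi
    simp at hi
    rw [if_pos (by omega)]
  have h2 : ∑ x ∈ Finset.range m, (if 2 * (m + 1 + x) ≠ 2 * m then p ^ (m + 1 + x) else 0)
      = p ^ (m + 1) * G p m := by
    rw [G, Finset.mul_sum]
    apply Finset.sum_congr rfl
    intro i hi
    rw [if_pos (by omega), pow_add]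
  rw [h1, h2]; ring

lemma sbu_one : sbu 1 = 1 := by
  classical
  rw [sbu_eq]
  simp [IsBiunitaryDivisor]
  intro c hc
  have := hc.1
  simp at this
  exact this

lemma sbu_ge {n : ℕ} (hn : 1 < n) : n + 1 ≤ sbu n := by
  classical
  rw [sbu]
  have hsub : ({1, n} : Finset ℕ) ⊆ n.divisors.filter (fun d => IsBiunitaryDivisor d n) := by
    intro d hd
    simp at hd
    rw [Finset.mem_filter, Nat.mem_divisors]
    rcases hd with rfl | rfl
    · refine ⟨⟨one_dvd _, by omega⟩, one_dvd _, fun c h _ => ?_⟩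
      simpa using h.1
    · refine ⟨⟨dvd_rfl, by omega⟩, dvd_rfl, fun c _ h => ?_⟩
      rw [Nat.div_self (by omega)] at h
      simpa using h.1
  calc n + 1 = ∑ d ∈ ({1, n} : Finset ℕ), d := by
        rw [Finset.sum_pair (by omega)]; ring
    _ ≤ _ := by
      exact le_of_le_of_eq (Finset.sum_le_sum_of_subset hsub) (by congr)

lemma sbu_ge' {n : ℕ} (hn : 0 < n) : n ≤ sbu n := by
  rcases Nat.lt_or_ge 1 n with h | h
  · have := sbu_ge h; omega
  · have : n = 1 := by omega
    subst this; rw [sbu_one]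

/-- Split off a prime power. -/
lemma split {n p : ℕ} (hn : 0 < n) (hp : p.Prime) (h : p ∣ n) :
    ∃ e m, 0 < e ∧ 0 < m ∧ n = p ^ e * m ∧ ¬ p ∣ m ∧ sbu n = sbu (p ^ e) * sbu m := by
  obtain ⟨e, m, hm, rfl⟩ := Nat.exists_eq_pow_mul_and_not_dvd hn.ne' p hp.ne_one
  have hm0 : 0 < m := Nat.pos_of_ne_zero (by rintro rfl; simp at hm)
  refine ⟨e, m, ?_, hm0, rfl, hm, sbu_mul (pow_pos hp.pos _) hm0 ?_⟩
  · rcases Nat.eq_zero_or_pos e with rfl | h0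
    · simp at h; exact absurd h hm
    · exact h0
  · exact Nat.Coprime.pow_left _ ((Nat.Prime.coprime_iff_not_dvd hp).2 hm)

lemma sbu_pp_even {p : ℕ} (hp : p.Prime) (h2 : Odd p) {e : ℕ} (he : 0 < e) :
    2 ∣ sbu (p ^ e) := by
  have : ∀ k, 2 ∣ p ^ k + 1 := fun k => ((h2.pow).add_one).two_dvd
  rcases Nat.even_or_odd' e with ⟨m, rfl | rfl⟩
  · rw [sbu_even_pow hp (by omega)]
    exact (this _).mul_left _
  · rw [sbu_odd_pow hp]
    exact (this _).mul_left _

lemma sbu_even {n : ℕ} (hn : 1 < n) (h2 : Odd n) : 2 ∣ sbu n := by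
  have hp := Nat.minFac_prime hn.ne'
  obtain ⟨e, m, he, hm, h, -, hs⟩ := split (by omega) hp (Nat.minFac_dvd n)
  rw [hs]
  exact (sbu_pp_even hp (Odd.of_dvd_nat h2 (Nat.minFac_dvd n)) he).mul_right _

lemma G_succ (p m : ℕ) : G p (m + 1) = 1 + p * G p m := by
  rw [add_comm, G, sum_split]
  simp [G]

lemma G_geom (p m : ℕ) (hp : 1 ≤ p) : G p m * (p - 1) + 1 = p ^ m := by
  induction m with
  | zero => simp [G]
  | succ k ih =>
    obtain ⟨r, rfl⟩ := Nat.exists_eq_add_of_le hp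
    rw [G_succ, pow_succ, ← ih]
    simp
    ring

lemma sbu_two_odd (m : ℕ) : sbu (2 ^ (2 * m + 1)) + 1 = 2 ^ (2 * m + 2) := by
  have h := G_geom 2 (m + 1) (by norm_num)
  rw [sbu_odd_pow Nat.prime_two]
  simp at h
  rw [show 2 ^ (2 * m + 2) = 2 ^ (m + 1) * 2 ^ (m + 1) by ring, ← h]; ring

lemma sbu_two_even {m : ℕ} (hm : 0 < m) : sbu (2 ^ (2 * m)) = (2 ^ m - 1) * (2 ^ (m + 1) + 1) := by
  have h := G_geom 2 m (by norm_num)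
  rw [sbu_even_pow Nat.prime_two hm]
  simp at h
  rw [← h]; simp

lemma sbu_two_pow_odd (f : ℕ) : Odd (sbu (2 ^ f)) := by
  rcases Nat.eq_zero_or_pos f with rfl | hf
  · simp [sbu_one]
  rcases Nat.even_or_odd' f with ⟨m, rfl | rfl⟩
  · rw [sbu_two_even (by omega)]
    have : Even (2 ^ m) := (Nat.even_pow).2 ⟨by norm_num, by omega⟩
    have h1 : Even (2 ^ (m + 1)) := (Nat.even_pow).2 ⟨by norm_num, by omega⟩
    exact (Nat.Even.sub_odd Nat.one_le_two_pow this odd_one).mul h1.add_one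
  · have := sbu_two_odd m
    have h1 : Even (2 ^ (2 * m + 2)) := (Nat.even_pow).2 ⟨by norm_num, by omega⟩
    rw [← this] at h1
    exact (Nat.even_add_one.1 h1) |> Nat.not_even_iff_odd.1

end BU

namespace BU

/-- The only primes dividing `x` are `2` and `q`. -/
def H (q x : ℕ) : Prop := ∀ r, r.Prime → r ∣ x → r = 2 ∨ r = q

lemma H.dvd {q x y : ℕ} (h : H q x) (hy : y ∣ x) : H q y :=
  fun r hr hd => h r hr (hd.trans hy)

lemma H.odd {q x : ℕ} (h : H q x) (ho : Odd x) (h1 : 1 < x) : q ∣ x := by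
  have hp := Nat.minFac_prime h1.ne'
  have hd := Nat.minFac_dvd x
  rcases h _ hp hd with h2 | h2
  · rw [h2] at hd
    exact absurd ho (Nat.not_odd_iff_even.2 (even_iff_two_dvd.2 hd))
  · rwa [h2] at hd

lemma H.two {q x : ℕ} (h : H q x) (ho : x % 4 = 2) (h1 : 2 < x) : q ∣ x := by
  have hd : x / 2 ∣ x := Nat.div_dvd_of_dvd (by omega)
  exact ((h.dvd hd).odd (Nat.odd_iff.2 (by omega)) (by omega)).trans hd

lemma even_pow_mod {p k : ℕ} (hp : Odd p) (hk : Even k) : (p ^ k + 1) % 4 = 2 := by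
  obtain ⟨j, rfl⟩ := hk
  have h1 : p % 4 = 1 ∨ p % 4 = 3 := by have := Nat.odd_iff.1 hp; omega
  have h2 : p ^ 2 % 4 = 1 := by rcases h1 with h | h <;> simp [Nat.pow_mod, h]
  have h3 : p ^ (j + j) % 4 = 1 := by
    rw [← two_mul, pow_mul, Nat.pow_mod, h2]; simp
  omega

lemma G_odd {p m : ℕ} (hp : Odd p) (hm : Odd m) : Odd (G p m) := by
  rw [G, Finset.odd_sum_iff_odd_card_odd]
  simp [hp.pow, hm]

lemma G_gt {p m : ℕ} (hp : 0 < p) (hm : 2 ≤ m) : 1 < G p m := by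
  obtain ⟨k, rfl⟩ := Nat.exists_eq_add_of_le' hm
  rw [G_succ, G_succ]
  have : 0 < p * (1 + p * G p k) := by positivity
  omega

lemma exists_R {p : ℕ} (hp : Odd p) (j : ℕ) :
    ∃ R, Odd R ∧ p ^ (2 * j + 1) + 1 = (p + 1) * R := by
  induction j with
  | zero => exact ⟨1, by simp, by simp⟩
  | succ j ih =>
    obtain ⟨R, hR, h⟩ := ih
    have hR0 : 0 < R := hR.pos
    have hle : p ≤ p ^ 2 * R + 1 := by nlinarith [hp.pos]
    obtain ⟨S, hS⟩ := Nat.exists_eq_add_of_le hle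
    refine ⟨S, ?_, ?_⟩
    · have : Even (p ^ 2 * R + 1) := ((hp.pow).mul hR).add_one
      rw [hS, Nat.even_add] at this
      exact Nat.not_even_iff_odd.1 fun h => (Nat.not_even_iff_odd.2 hp) (this.2 h)
    · have e1 : p ^ (2 * (j + 1) + 1) = p ^ 2 * p ^ (2 * j + 1) := by ring
      zify at *
      have e2 : (S : ℤ) = p ^ 2 * R + 1 - p := by linarith
      rw [e1, e2]
      have e3 : (p : ℤ) ^ (2 * j + 1) = (p + 1) * R - 1 := by linarith
      rw [e3]; ring

lemma dvd_pow_add {p q m : ℕ} (hp : Odd p) (h3 : 3 ≤ p) (hm : 2 ≤ m) (h : H q (p ^ m + 1)) :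
    q ∣ p ^ m + 1 := by
  rcases Nat.even_or_odd' m with ⟨j, rfl | rfl⟩
  · refine h.two (even_pow_mod hp (by simp)) ?_
    have : p ^ 2 ≤ p ^ (2 * j) := Nat.pow_le_pow_right (by omega) hm
    nlinarith
  · obtain ⟨R, hR, e⟩ := exists_R hp j
    have hd : R ∣ p ^ (2 * j + 1) + 1 := ⟨p + 1, by rw [e]; ring⟩
    refine ((h.dvd hd).odd hR ?_).trans hd
    have : p ^ 2 ≤ p ^ (2 * j + 1) := Nat.pow_le_pow_right (by omega) hm
    by_contra hc
    have : R = 1 := by have := hR.pos; omega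
    subst this
    nlinarith

lemma G_dvd_even (p j : ℕ) : G p (2 * j) = G p j * (p ^ j + 1) := by
  rw [two_mul, G, sum_split]; ring

lemma dvd_G {p q m : ℕ} (hp : Odd p) (h3 : 3 ≤ p) (hm : 3 ≤ m) (h : H q (G p m)) :
    q ∣ G p m := by
  rcases Nat.even_or_odd' m with ⟨j, rfl | rfl⟩
  · rw [G_dvd_even] at *
    have hd : p ^ j + 1 ∣ G p j * (p ^ j + 1) := dvd_mul_left _ _
    exact (dvd_pow_add hp h3 (by omega) (h.dvd hd)).trans hd
  · exact h.odd (G_odd hp (by simp)) (G_gt (by omega) (by omega))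

lemma zmod_G {p q m : ℕ} (hp : 1 ≤ p) (h : q ∣ G p m) : (p : ZMod q) ^ m = 1 := by
  have := congrArg (fun x : ℕ => (x : ZMod q)) (G_geom p m hp)
  simp only [Nat.cast_add, Nat.cast_mul, Nat.cast_pow, (ZMod.natCast_eq_zero_iff _ _).2 h] at this
  simpa using this.symm

lemma zmod_P {p q m : ℕ} (h : q ∣ p ^ m + 1) : (p : ZMod q) ^ m = -1 := by
  have := (ZMod.natCast_eq_zero_iff _ _).2 h
  push_cast at this
  linear_combination this

lemma two_ne {q : ℕ} (hq : q.Prime) (ho : Odd q) : (2 : ZMod q) ≠ 0 := by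
  intro h
  have h' : ((2 : ℕ) : ZMod q) = 0 := by exact_mod_cast h
  rw [ZMod.natCast_eq_zero_iff, Nat.prime_dvd_prime_iff_eq hq Nat.prime_two] at h'
  subst h'
  exact absurd ho (by decide)

lemma lte {p q n : ℕ} (hp : Odd p) (h3 : 3 ≤ p) (hq : q.Prime) (ho : Odd q) (hn : Odd n)
    (hn3 : 3 ≤ n) (hd : q ∣ p + 1) (h : H q (p ^ n + 1)) : False := by
  have := Fact.mk hq
  obtain ⟨j, rfl⟩ := id hn
  obtain ⟨R, hR, e⟩ := exists_R hp j
  have hqp : ¬ q ∣ p := by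
    intro h
    have := (Nat.dvd_add_right h).1 hd
    exact hq.one_lt.ne' (Nat.dvd_one.1 this)
  have h1 := padicValNat.pow_add_pow (p := q) (x := p) (y := 1) ho hd hqp hn
  rw [one_pow, e, padicValNat.mul (by omega) hR.pos.ne'] at h1
  have h2 : R = q ^ R.primeFactorsList.length := by
    apply Nat.eq_prime_pow_of_unique_prime_dvd hR.pos.ne'
    intro d hdp hdR
    rcases h d hdp (hdR.trans ⟨p + 1, by rw [e]; ring⟩) with rfl | h
    · exact absurd hR (Nat.not_odd_iff_even.2 (even_iff_two_dvd.2 hdR))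
    · exact h
  have h4 : padicValNat q R = R.primeFactorsList.length := by
    conv_lhs => rw [h2]
    simp
  have h5 : R ∣ 2 * j + 1 := by
    rw [h2, ← h4, show padicValNat q R = padicValNat q (2 * j + 1) by omega]
    exact pow_padicValNat_dvd
  have h6 := Nat.le_of_dvd (by omega) h5
  have h7 : ∀ n, 3 ≤ n → (p + 1) * n ≤ p ^ n := by
    intro n hn
    induction n, hn using Nat.le_induction with
    | base => nlinarith [Nat.mul_le_mul h3 h3, Nat.mul_le_mul (Nat.mul_le_mul h3 h3) (le_refl p)]
    | succ n hn ih =>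
      rw [pow_succ]
      have k1 : (p + 1) * 1 ≤ (p + 1) * n := Nat.mul_le_mul_left _ (by omega)
      have k2 : p ^ n * 3 ≤ p ^ n * p := Nat.mul_le_mul_left _ h3
      linarith
  have h8 := h7 _ hn3
  have h9 := Nat.mul_le_mul_left (p + 1) h6
  omega

lemma classify {p q e : ℕ} (hpp : p.Prime) (hp : Odd p) (hq : q.Prime) (ho : Odd q)
    (h : H q (sbu (p ^ e))) : e ≤ 4 := by
  have h3 : 3 ≤ p := by
    have := hpp.two_le
    rcases hp with ⟨k, rfl⟩; omega
  have h2 := two_ne hq ho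
  by_contra hc
  rcases Nat.even_or_odd' e with ⟨m, rfl | rfl⟩
  · rw [sbu_even_pow hpp (by omega)] at h
    have a := zmod_G (by omega) (dvd_G hp h3 (by omega) (h.dvd (dvd_mul_right _ _)))
    have hP := h.dvd (dvd_mul_left _ _)
    have b := zmod_P (dvd_pow_add hp h3 (by omega) hP)
    rw [pow_succ, a, one_mul] at b
    rcases Nat.even_or_odd m with hm | hm
    · refine lte hp h3 hq ho hm.add_one (by omega) ?_ hP
      rw [← ZMod.natCast_eq_zero_iff]
      push_cast
      rw [b]; ring
    · rw [b, hm.neg_one_pow] at a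
      exact h2 (by linear_combination -a)
  · rw [sbu_odd_pow hpp] at h
    have a := zmod_G (by omega) (dvd_G hp h3 (by omega) (h.dvd (dvd_mul_right _ _)))
    have b := zmod_P (dvd_pow_add hp h3 (by omega) (h.dvd (dvd_mul_left _ _)))
    exact h2 (by linear_combination b - a)

lemma sbu1 {p : ℕ} (hp : p.Prime) : sbu p = p + 1 := by
  have := sbu_odd_pow hp 0
  simpa [G] using this

lemma sbu2 {p : ℕ} (hp : p.Prime) : sbu (p ^ 2) = p ^ 2 + 1 := by
  have := sbu_even_pow hp (m := 1) (by norm_num)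
  simpa [G] using this

lemma sbu3 {p : ℕ} (hp : p.Prime) : sbu (p ^ 3) = (p + 1) * (p ^ 2 + 1) := by
  have := sbu_odd_pow hp 1
  rw [show G p (1 + 1) = p + 1 by simp [G, Finset.sum_range_succ]; ring] at this
  simpa using this

lemma sbu4 {p : ℕ} (hp : p.Prime) : sbu (p ^ 4) = (p + 1) * (p ^ 3 + 1) := by
  have := sbu_even_pow hp (m := 2) (by norm_num)
  rw [show G p 2 = p + 1 by simp [G, Finset.sum_range_succ]; ring] at this
  simpa using this

lemma classify1 {p q e : ℕ} (hpp : p.Prime) (hp : p % 4 = 1) (hq : q.Prime) (ho : Odd q)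
    (h : H q (sbu (p ^ e))) : e ≤ 2 := by
  have hpo : Odd p := Nat.odd_iff.2 (by omega)
  have h3 : 3 ≤ p := by
    have := hpp.two_le
    omega
  have h2 := two_ne hq ho
  have h4 := classify hpp hpo hq ho h
  by_contra hc
  obtain rfl | rfl : e = 3 ∨ e = 4 := by omega
  · rw [sbu3 hpp] at h
    have a : q ∣ p ^ 1 + 1 := by
      rw [pow_one]; exact (h.dvd (dvd_mul_right _ _)).two (by omega) (by omega)
    have a := zmod_P a
    have b := zmod_P (dvd_pow_add hpo h3 (by omega) (h.dvd (dvd_mul_left _ _)))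
    rw [pow_one] at a
    rw [a] at b
    exact h2 (by linear_combination b)
  · rw [sbu4 hpp] at h
    exact lte hpo h3 hq ho (by decide) (by omega)
      ((h.dvd (dvd_mul_right _ _)).two (by omega) (by omega)) (h.dvd (dvd_mul_left _ _))

lemma no_three {p e : ℕ} (hpp : p.Prime) (hp : Odd p) (he : 2 ≤ e)
    (h : H 3 (sbu (p ^ e))) : False := by
  have h3 : 3 ≤ p := by
    have := hpp.two_le
    rcases hp with ⟨k, rfl⟩; omega
  have h4 := classify hpp hp Nat.prime_three (by decide) h
  have key : H 3 (p ^ 2 + 1) → False := by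
    intro h
    have := dvd_pow_add hp h3 (by omega) h
    have hm : p % 3 = 0 ∨ p % 3 = 1 ∨ p % 3 = 2 := by omega
    rcases hm with h | h | h <;> simp [Nat.dvd_iff_mod_eq_zero, Nat.add_mod, Nat.pow_mod, h] at this
  obtain rfl | rfl | rfl : e = 2 ∨ e = 3 ∨ e = 4 := by omega
  · rw [sbu2 hpp] at h
    exact key h
  · rw [sbu3 hpp] at h
    exact key (h.dvd (dvd_mul_left _ _))
  · rw [sbu4 hpp] at h
    have hP := h.dvd (dvd_mul_left _ _)
    have := dvd_pow_add hp h3 (by omega) hP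
    refine lte hp h3 Nat.prime_three (by decide) (by decide) (le_refl 3) ?_ hP
    have hm : p % 3 = 0 ∨ p % 3 = 1 ∨ p % 3 = 2 := by omega
    rcases hm with h | h | h <;>
      simp [Nat.dvd_iff_mod_eq_zero, Nat.add_mod, Nat.pow_mod, h] at this ⊢

/-- The basic data attached to an odd solution. -/
structure Data (N f q g : ℕ) : Prop where
  hN : 1 < N
  odd : Odd N
  f0 : 0 < f
  g0 : 0 < g
  hq : q.Prime
  qodd : Odd q
  s1 : sbu N = 2 ^ f * q ^ g
  s2 : 2 * N = sbu (2 ^ f) * sbu (q ^ g)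

lemma exists_data {N : ℕ} (hN : 0 < N) (hodd : Odd N) (h : sbu (sbu N) = 2 * N) :
    ∃ f q g, Data N f q g := by
  have hN1 : 1 < N := by
    by_contra hc
    have : N = 1 := by omega
    subst this
    simp [sbu_one] at h
  have hev := sbu_even hN1 hodd
  have hpos : 0 < sbu N := by have := sbu_ge hN1; omega
  obtain ⟨f, m, hf, hm, e, h2m, hs⟩ := split hpos Nat.prime_two hev
  have hmo : Odd m := Nat.not_even_iff_odd.1 fun h => h2m h.two_dvd
  have hm1 : 1 < m := by
    by_contra hc
    have : m = 1 := by omega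
    subst this
    rw [sbu_one, mul_one, h] at hs
    have := sbu_two_pow_odd f
    rw [← hs] at this
    exact absurd this (by simp)
  have hq := Nat.minFac_prime hm1.ne'
  have hqo : Odd m.minFac := Odd.of_dvd_nat hmo (Nat.minFac_dvd m)
  obtain ⟨g, k, hg, hk, e', hqk, hs'⟩ := split hm hq (Nat.minFac_dvd m)
  have hk1 : k = 1 := by
    by_contra hc
    have hko : Odd k := Odd.of_dvd_nat hmo ⟨_, by rw [mul_comm]; exact e'⟩
    obtain ⟨a, ha⟩ := sbu_even (by omega) hko
    obtain ⟨b, hb⟩ := sbu_pp_even hq hqo hg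
    rw [h, hs', ha, hb] at hs
    have : N = 2 * (sbu (2 ^ f) * b * a) := by linarith
    rw [this] at hodd
    exact absurd hodd (by simp)
  rw [hk1, mul_one] at e'
  refine ⟨f, m.minFac, g, hN1, hodd, hf, hg, hq, hqo, ?_, ?_⟩
  · rw [← e']; exact e
  · rw [← e', ← hs, h]

lemma Data.comp {N f q g p : ℕ} (D : Data N f q g) (hp : p.Prime) (hd : p ∣ N) :
    ∃ e n, 0 < e ∧ 0 < n ∧ Odd n ∧ N = p ^ e * n ∧ ¬ p ∣ n ∧ sbu N = sbu (p ^ e) * sbu n ∧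
      H q (sbu (p ^ e)) ∧ e ≤ 4 ∧ (p % 4 = 1 → e ≤ 2) ∧
      sbu (2 ^ f) * (p ^ e + 1) < 2 ^ (f + 1) * p ^ e := by
  obtain ⟨e, n, he, hn, h, hpn, hs⟩ := split (by have := D.hN; omega) hp hd
  have hpo : Odd p := Odd.of_dvd_nat D.odd hd
  have hH : H q (sbu (p ^ e)) := by
    intro r hr hrd
    have : r ∣ 2 ^ f * q ^ g := by rw [← D.s1, hs]; exact hrd.mul_right _
    rcases (Nat.Prime.dvd_mul hr).1 this with h | h
    · left; exact (Nat.prime_dvd_prime_iff_eq hr Nat.prime_two).1 (hr.dvd_of_dvd_pow h)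
    · right; exact (Nat.prime_dvd_prime_iff_eq hr D.hq).1 (hr.dvd_of_dvd_pow h)
  refine ⟨e, n, he, hn, Odd.of_dvd_nat D.odd ⟨_, by rw [mul_comm]; exact h⟩, h, hpn, hs, hH,
    classify hp hpo D.hq D.qodd hH, fun h1 => classify1 hp h1 D.hq D.qodd hH, ?_⟩
  have a1 : p ^ e + 1 ≤ sbu (p ^ e) := sbu_ge (Nat.one_lt_pow he.ne' hp.one_lt)
  have a2 : n ≤ sbu n := sbu_ge' hn
  have a3 : q ^ g + 1 ≤ sbu (q ^ g) := sbu_ge (Nat.one_lt_pow D.g0.ne' D.hq.one_lt)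
  have s1 := D.s1
  have s2 := D.s2
  have hS : 0 < sbu (2 ^ f) := (sbu_two_pow_odd f).pos
  have hQ : 0 < q ^ g := pow_pos D.hq.pos _
  have b1 : (p ^ e + 1) * n ≤ 2 ^ f * q ^ g := by
    rw [← s1, hs]; exact Nat.mul_le_mul a1 a2
  have b2 : sbu (2 ^ f) * (q ^ g + 1) ≤ 2 * (p ^ e * n) := by
    rw [← h, s2]; exact Nat.mul_le_mul_left _ a3
  have hP : 0 < p ^ e := pow_pos hp.pos _
  rw [pow_succ]
  generalize sbu (2 ^ f) = S at *
  generalize p ^ e = P at *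
  generalize q ^ g = Q at *
  generalize 2 ^ f = F at *
  have c1 : S * (Q + 1) * (P + 1) ≤ 2 * P * (F * Q) := by
    calc S * (Q + 1) * (P + 1) ≤ 2 * (P * n) * (P + 1) := Nat.mul_le_mul_right _ b2
      _ = 2 * P * ((P + 1) * n) := by ring
      _ ≤ _ := Nat.mul_le_mul_left _ b1
  have c2 : Q * (S * (P + 1)) < Q * (F * 2 * P) := by
    have : 0 < S * (P + 1) := by positivity
    nlinarith
  exact Nat.lt_of_mul_lt_mul_left c2

end BU

namespace BU

lemma Data.dvdS {N f q g r : ℕ} (D : Data N f q g) (hr : r.Prime) (h : r ∣ sbu (2 ^ f)) :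
    r ∣ N := by
  have hro : Odd r := Odd.of_dvd_nat (sbu_two_pow_odd f) h
  have : r ∣ 2 * N := by rw [D.s2]; exact h.mul_right _
  rcases (Nat.Prime.dvd_mul hr).1 this with h | h
  · rw [Nat.prime_dvd_prime_iff_eq hr Nat.prime_two] at h
    subst h
    exact absurd hro (by decide)
  · exact h

lemma three_dvd_even {k : ℕ} (hk : Even k) : 3 ∣ 2 ^ k - 1 := by
  obtain ⟨j, rfl⟩ := hk
  rw [← two_mul, pow_mul]
  simpa using Nat.sub_dvd_pow_sub_pow 4 1 j

lemma H.eq {q x r : ℕ} (h : H q x) (hr : r.Prime) (h2 : r ≠ 2) (hd : r ∣ x) : q = r := by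
  rcases h r hr hd with h | h
  · exact absurd h h2
  · exact h.symm

lemma three_pow_le {e : ℕ} (he : e ≤ 4) : 3 ^ e ≤ 81 :=
  (Nat.pow_le_pow_right (by norm_num) he).trans (by norm_num)

lemma five_pow_le {e : ℕ} (he : e ≤ 2) : 5 ^ e ≤ 25 :=
  (Nat.pow_le_pow_right (by norm_num) he).trans (by norm_num)

lemma not4 {g q : ℕ} (ho : Odd q) (a : ℕ) (h : 2 * (2 * a) = 2 * q ^ g) : False := by
  have h1 : Odd (q ^ g) := ho.pow
  have : q ^ g = 2 * a := by omega
  rw [this] at h1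
  exact absurd h1 (by simp)

/-- If `sbu n = 2 * q ^ g`, then `n + 1 = sbu n`. -/
lemma single {n q g : ℕ} (hn : 0 < n) (hno : Odd n) (hq : q.Prime) (ho : Odd q)
    (h : sbu n = 2 * q ^ g) : sbu n = n + 1 := by
  have hn1 : 1 < n := by
    by_contra hc
    have : n = 1 := by omega
    subst this
    rw [sbu_one] at h
    omega
  have hp := Nat.minFac_prime hn1.ne'
  have hpo : Odd n.minFac := Odd.of_dvd_nat hno (Nat.minFac_dvd n)
  obtain ⟨e, k, he, hk, e1, -, hs⟩ := split hn hp (Nat.minFac_dvd n)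
  generalize n.minFac = p at *
  have hk1 : k = 1 := by
    by_contra hc
    have hko : Odd k := Odd.of_dvd_nat hno ⟨_, by rw [mul_comm]; exact e1⟩
    obtain ⟨a, ha⟩ := sbu_even (by omega) hko
    obtain ⟨b, hb⟩ := sbu_pp_even hp hpo he
    rw [hs, ha, hb] at h
    exact not4 ho (b * a) (by rw [← h]; ring)
  subst hk1
  rw [mul_one] at e1
  have hH : H q (sbu (p ^ e)) := by
    intro r hr hd
    rw [← e1, h] at hd
    rcases (Nat.Prime.dvd_mul hr).1 hd with h | h
    · left; exact (Nat.prime_dvd_prime_iff_eq hr Nat.prime_two).1 h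
    · right; exact (Nat.prime_dvd_prime_iff_eq hr hq).1 (hr.dvd_of_dvd_pow h)
  have h4 := classify hp hpo hq ho hH
  subst e1
  obtain ⟨a, ha⟩ : 2 ∣ p + 1 := hpo.add_one.two_dvd
  obtain rfl | rfl | rfl | rfl : e = 1 ∨ e = 2 ∨ e = 3 ∨ e = 4 := by omega
  · rw [pow_one, sbu1 hp]
  · rw [sbu2 hp]
  · exfalso
    obtain ⟨b, hb⟩ : 2 ∣ p ^ 2 + 1 := (hpo.pow).add_one.two_dvd
    rw [sbu3 hp, ha, hb] at h
    exact not4 ho (a * b) (by rw [← h]; ring)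
  · exfalso
    obtain ⟨b, hb⟩ : 2 ∣ p ^ 3 + 1 := (hpo.pow).add_one.two_dvd
    rw [sbu4 hp, ha, hb] at h
    exact not4 ho (a * b) (by rw [← h]; ring)

lemma case_one {N q g : ℕ} (D : Data N 1 q g) : N = 9 := by
  have hS : sbu (2 ^ 1) = 3 := by rw [pow_one, sbu1 Nat.prime_two]
  have s1 := D.s1
  have h1 := single (by have := D.hN; omega) D.odd D.hq D.qodd (by simpa using s1)
  obtain ⟨e, n, he, hn, hno, h, -, hs, hH, h4, -, -⟩ :=
    D.comp Nat.prime_three (D.dvdS Nat.prime_three (by rw [hS]))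
  have hn1 : n = 1 := by
    by_contra hc
    have a1 := sbu_ge (n := 3 ^ e) (Nat.one_lt_pow he.ne' (by norm_num))
    have a2 := sbu_ge (n := n) (by omega)
    have := Nat.mul_le_mul a1 a2
    rw [← hs, h1, h] at this
    have : 0 < 3 ^ e := by positivity
    nlinarith
  subst hn1
  rw [mul_one] at h
  subst h
  rw [h1] at s1
  obtain rfl | rfl | rfl | rfl : e = 1 ∨ e = 2 ∨ e = 3 ∨ e = 4 := by omega
  · exfalso
    exact not4 D.qodd 1 (by simpa using s1)
  · norm_num
  · rw [sbu3 Nat.prime_three] at h1; norm_num at h1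
  · rw [sbu4 Nat.prime_three] at h1; norm_num at h1

lemma case_two {N q g : ℕ} (D : Data N 2 q g) : False := by
  have hS : sbu (2 ^ 2) = 5 := by rw [sbu2 Nat.prime_two]; norm_num
  have p5 : Nat.Prime 5 := by norm_num
  obtain ⟨e, n, he, hn, hno, h, h5n, hs, hH, h4, h2, -⟩ :=
    D.comp p5 (D.dvdS p5 (by rw [hS]))
  have h2 := h2 (by norm_num)
  have s1 := D.s1
  have s2 := D.s2
  have hq := D.hq
  have ho := D.qodd
  obtain ⟨k, hk⟩ : ∃ k, g = k + 1 := ⟨g - 1, by have := D.g0; omega⟩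
  rw [hS] at s2
  rw [hs] at s1
  obtain rfl | rfl : e = 1 ∨ e = 2 := by omega
  · rw [pow_one, sbu1 p5] at hH
    have hq3 := hH.eq Nat.prime_three (by norm_num) (by norm_num)
    subst hq3
    rw [hk, pow_one, sbu1 p5, pow_succ 3 k] at s1
    have hs' : sbu n = 2 * 3 ^ k := by omega
    have h1 := single hn hno hq ho hs'
    have s3 : 2 * n = sbu (3 ^ g) := by omega
    have hg : sbu (3 ^ g) + 2 = 4 * 3 ^ k := by omega
    rcases Nat.even_or_odd' g with ⟨m, rfl | rfl⟩
    · rw [sbu_even_pow hq (by omega)] at hg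
      obtain ⟨j, rfl⟩ : ∃ j, m = j + 1 := ⟨m - 1, by omega⟩
      have hkj : k = 2 * j + 1 := by omega
      have hG := G_geom 3 (j + 1) (by norm_num)
      subst hkj
      have e1 : 3 ^ (2 * j + 1) = 3 * (3 ^ j * 3 ^ j) := by ring
      rw [e1] at hg
      rw [show 3 ^ (j + 1 + 1) = 9 * 3 ^ j by ring] at hg
      rw [show 3 ^ (j + 1) = 3 * 3 ^ j by ring] at hG
      rw [e1] at hs'
      have hy : 3 ^ j = 1 := by
        generalize 3 ^ j = y at *
        generalize G 3 (j + 1) = z at *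
        zify at *
        have : (y - 1 : ℤ) ^ 2 = 0 := by
          have hz : (z : ℤ) * 2 = 3 * y - 1 := by push_cast at hG; linarith
          have : (z * 2 : ℤ) * (9 * y + 1) + 4 = 24 * (y * y) := by linarith
          rw [hz] at this
          nlinarith
        have := pow_eq_zero_iff (two_ne_zero) |>.1 this
        linarith
      rw [hy] at hs'
      have : n = 5 := by omega
      exact h5n (by rw [this])
    · rw [sbu_odd_pow hq] at hg
      have hkj : k = 2 * m := by omega
      subst hkj
      have hG := G_geom 3 (m + 1) (by norm_num)
      rw [show 3 ^ (2 * m) = 3 ^ m * 3 ^ m by ring] at hg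
      rw [show 3 ^ (m + 1) = 3 * 3 ^ m by ring] at hG hg
      generalize 3 ^ m = y at *
      generalize G 3 (m + 1) = z at *
      have hz : z * 2 + 1 = 3 * y := by simpa using hG
      have : (z * 2 + 1) * (3 * y + 1) + 4 = 8 * (y * y) + (3 * y + 1) := by nlinarith
      rw [hz] at this
      nlinarith
  · rw [sbu2 p5] at hH s1
    have hq3 := hH.eq (r := 13) (by norm_num) (by norm_num) (by norm_num)
    subst hq3
    rw [hk, pow_succ 13 k] at s1
    have hs' : sbu n = 2 * 13 ^ k := by omega
    have h1 := single hn hno hq ho hs'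
    have hmod : sbu (13 ^ g) % 13 = 1 := by
      have key : ∀ m, G 13 (m + 1) % 13 = 1 := by
        intro m; rw [G_succ]; omega
      have key2 : ∀ m, (13 ^ (m + 1) + 1) % 13 = 1 := by
        intro m; rw [pow_succ]; omega
      rcases Nat.even_or_odd' g with ⟨m, rfl | rfl⟩
      · obtain ⟨j, rfl⟩ : ∃ j, m = j + 1 := ⟨m - 1, by omega⟩
        rw [sbu_even_pow hq (by omega), Nat.mul_mod, key, key2]
      · rw [sbu_odd_pow hq, Nat.mul_mod, key, key2]
    rcases Nat.eq_zero_or_pos k with rfl | hk0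
    · have : n = 1 := by omega
      subst this
      rw [sbu_one] at hs'
      omega
    · obtain ⟨j, rfl⟩ : ∃ j, k = j + 1 := ⟨k - 1, by omega⟩
      rw [pow_succ] at hs'
      omega

lemma case_four {N q g : ℕ} (D : Data N 4 q g) : False := by
  have hS : sbu (2 ^ 4) = 27 := by rw [sbu4 Nat.prime_two]; norm_num
  obtain ⟨e, n, he, hn, hno, h, h3n, hs, hH, h4, -, -⟩ :=
    D.comp Nat.prime_three (D.dvdS Nat.prime_three (by rw [hS]; norm_num))
  have s1 := D.s1
  have s2 := D.s2
  obtain ⟨k, hk⟩ : ∃ k, g = k + 1 := ⟨g - 1, by have := D.g0; omega⟩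
  rw [hS] at s2
  have h27 : ¬ (e = 1) ∧ ¬ (e = 2) := by
    constructor <;> rintro rfl <;> omega
  have hq := D.hq
  have hge := sbu_ge (n := q ^ g) (Nat.one_lt_pow D.g0.ne' hq.one_lt)
  rw [hs] at s1
  have hn' := sbu_ge' hn
  obtain rfl | rfl : e = 3 ∨ e = 4 := by omega
  · rw [sbu3 Nat.prime_three] at hH s1
    have hq3 := hH.eq (r := 5) (by norm_num) (by norm_num) (by norm_num)
    subst hq3
    have : 5 ^ g = 5 ^ k * 5 := by rw [hk, pow_succ]
    omega
  · rw [sbu4 Nat.prime_three] at hH s1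
    have hq3 := hH.eq (r := 7) (by norm_num) (by norm_num) (by norm_num)
    subst hq3
    have : 7 ^ g = 7 ^ k * 7 := by rw [hk, pow_succ]
    omega

lemma case_odd {N m q g : ℕ} (hm : 0 < m) (D : Data N (2 * m + 1) q g) : False := by
  have hS := sbu_two_odd m
  have bound : ∀ P, sbu (2 ^ (2 * m + 1)) * (P + 1) < 2 ^ (2 * m + 1 + 1) * P →
      2 ^ (2 * m + 2) ≤ P := by
    intro P hP
    rw [show 2 * m + 1 + 1 = 2 * m + 2 by ring, ← hS] at hP
    rw [← hS]
    nlinarith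
  have h3 : 3 ∣ sbu (2 ^ (2 * m + 1)) := by
    have := three_dvd_even (k := 2 * m + 2) (by simp [parity_simps])
    rwa [← hS] at this
  obtain ⟨e, n, he, hn, hno, h, h3n, hs, hH, h4, -, hb⟩ :=
    D.comp Nat.prime_three (D.dvdS Nat.prime_three h3)
  have hb := bound _ hb
  have hm2 : m ≤ 2 := by
    by_contra hc
    have : 2 ^ 8 ≤ 2 ^ (2 * m + 2) := Nat.pow_le_pow_right (by norm_num) (by omega)
    have := three_pow_le h4
    omega
  have he3 : e = 3 ∨ e = 4 := by
    have : 2 ^ 4 ≤ 2 ^ (2 * m + 2) := Nat.pow_le_pow_right (by norm_num) (by omega)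
    by_contra hc
    have : 3 ^ e ≤ 3 ^ 2 := Nat.pow_le_pow_right (by norm_num) (by omega)
    omega
  have hq57 : (e = 3 ∧ q = 5) ∨ (e = 4 ∧ q = 7) := by
    rcases he3 with rfl | rfl
    · left
      rw [sbu3 Nat.prime_three] at hH
      exact ⟨rfl, hH.eq (r := 5) (by norm_num) (by norm_num) (by norm_num)⟩
    · right
      rw [sbu4 Nat.prime_three] at hH
      exact ⟨rfl, hH.eq (r := 7) (by norm_num) (by norm_num) (by norm_num)⟩
  obtain rfl | rfl : m = 1 ∨ m = 2 := by omega
  · have p5 : Nat.Prime 5 := by norm_num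
    obtain ⟨e', n', he', -, -, -, -, -, hH', h4', h2', hb'⟩ :=
      D.comp p5 (D.dvdS p5 (by
        rw [show sbu (2 ^ (2 * 1 + 1)) = 15 by omega]; norm_num))
    have hb' := bound _ hb'
    have h2' := h2' (by norm_num)
    obtain rfl | rfl : e' = 1 ∨ e' = 2 := by omega
    · norm_num at hb'
    · rw [sbu2 p5] at hH'
      have := hH'.eq (r := 13) (by norm_num) (by norm_num) (by norm_num)
      omega
  · have p7 : Nat.Prime 7 := by norm_num
    obtain ⟨e', n', he', -, -, -, -, -, hH', h4', h2', hb'⟩ :=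
      D.comp p7 (D.dvdS p7 (by
        rw [show sbu (2 ^ (2 * 2 + 1)) = 63 by omega]; norm_num))
    have hb' := bound _ hb'
    have hq7 : q = 7 := by
      rcases hq57 with ⟨rfl, -⟩ | ⟨-, h⟩
      · norm_num at hb
      · exact h
    obtain rfl | rfl | rfl | rfl : e' = 1 ∨ e' = 2 ∨ e' = 3 ∨ e' = 4 := by omega
    · norm_num at hb'
    · norm_num at hb'
    · rw [sbu3 p7] at hH'
      have := hH'.eq (r := 5) (by norm_num) (by norm_num) (by norm_num)
      omega
    · rw [sbu4 p7] at hH'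
      have := hH'.eq (r := 43) (by norm_num) (by norm_num) (by norm_num)
      omega

lemma bound_even {s P : ℕ} (hs : 0 < s)
    (h : sbu (2 ^ (2 * s)) * (P + 1) < 2 ^ (2 * s + 1) * P) : 2 * 2 ^ s ≤ P + 2 := by
  rw [sbu_two_even hs, show 2 ^ (2 * s + 1) = 2 * (2 ^ s * 2 ^ s) by ring,
    show 2 ^ (s + 1) = 2 * 2 ^ s by ring] at h
  have hx : 0 < 2 ^ s := by positivity
  obtain ⟨y, hy⟩ : ∃ y, 2 ^ s = y + 1 := ⟨2 ^ s - 1, by omega⟩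
  rw [hy] at h ⊢
  simp only [Nat.add_sub_cancel] at h
  by_contra hc
  have hc1 : P + 1 ≤ 2 * y := by omega
  have hc2 := Nat.mul_le_mul_right (y + 2) hc1
  nlinarith

lemma case_even_even {N s q g : ℕ} (hs : 2 < s) (he : Even s) (D : Data N (2 * s) q g) :
    False := by
  have hS := sbu_two_even (m := s) (by omega)
  have h3 : 3 ∣ sbu (2 ^ (2 * s)) := by
    rw [hS]; exact (three_dvd_even he).mul_right _
  obtain ⟨e, n, he', hn, hno, h, h3n, hs', hH, h4, -, hb⟩ :=
    D.comp Nat.prime_three (D.dvdS Nat.prime_three h3)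
  have hb := bound_even (by omega) hb
  have := three_pow_le h4
  have hs6 : s < 6 := by
    by_contra hc
    have : 2 ^ 6 ≤ 2 ^ s := Nat.pow_le_pow_right (by norm_num) (by omega)
    omega
  obtain rfl : s = 4 := by rcases he with ⟨t, rfl⟩; omega
  have p5 : Nat.Prime 5 := by norm_num
  obtain ⟨e', n', -, -, -, -, -, -, -, -, h2', hb'⟩ :=
    D.comp p5 (D.dvdS p5 (by rw [hS]; norm_num))
  have hb' := bound_even (by omega) hb'
  have := five_pow_le (h2' (by norm_num))
  norm_num at hb'
  omega

lemma W_not {s b : ℕ} (hs : s % 4 = 3) (h : 2 * 2 ^ s * 2 ^ s + 2 * 2 ^ s + 1 = 5 ^ b) :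
    False := by
  obtain ⟨u, rfl⟩ : ∃ u, s = 4 * u + 3 := ⟨s / 4, by omega⟩
  have e1 : 2 ^ (4 * u + 3) = 8 * 16 ^ u := by rw [pow_add, pow_mul]; norm_num; ring
  rw [e1] at h
  have h16 : 5 ^ b % 16 = 1 := by
    rw [← h]
    have : 2 * (8 * 16 ^ u) * (8 * 16 ^ u) + 2 * (8 * 16 ^ u) + 1 =
      16 * (8 * (16 ^ u * 16 ^ u) + 16 ^ u) + 1 := by ring
    omega
  have hb : b % 4 = 0 := by
    have := Nat.div_add_mod b 4
    rw [← this, pow_add, pow_mul, Nat.mul_mod, Nat.pow_mod] at h16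
    have hlt : b % 4 < 4 := Nat.mod_lt _ (by norm_num)
    generalize b % 4 = c at *
    interval_cases c <;> simp at h16 ⊢
  have h13 : 5 ^ b % 13 = 1 := by
    have := Nat.div_add_mod b 4
    rw [← this, hb, pow_add, pow_mul, Nat.mul_mod, Nat.pow_mod]
    simp
  have hy : ∀ w, 16 ^ w % 13 = 1 ∨ 16 ^ w % 13 = 3 ∨ 16 ^ w % 13 = 9 := by
    intro w
    induction w with
    | zero => simp
    | succ w ih => rw [pow_succ]; omega
  have hy := hy u
  rw [← h] at h13
  rcases hy with hy | hy | hy <;> simp [Nat.add_mod, Nat.mul_mod, hy] at h13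

lemma case_even_odd {N s q g : ℕ} (hs : 2 < s) (he : s % 2 = 1) (D : Data N (2 * s) q g) :
    False := by
  have hS := sbu_two_even (m := s) (by omega)
  have hx8 : 2 ^ 3 ≤ 2 ^ s := Nat.pow_le_pow_right (by norm_num) (by omega)
  obtain h1 | h3 : s % 4 = 1 ∨ s % 4 = 3 := by omega
  · have p5 : Nat.Prime 5 := by norm_num
    have h5 : 5 ∣ 2 ^ (s + 1) + 1 := by
      obtain ⟨u, rfl⟩ : ∃ u, s = 4 * u + 1 := ⟨s / 4, by omega⟩
      rw [show 2 ^ (4 * u + 1 + 1) = 16 ^ u * 4 by rw [add_assoc, pow_add, pow_mul]; norm_num]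
      have : 16 ^ u % 5 = 1 := by rw [Nat.pow_mod]; simp
      omega
    obtain ⟨e', n', -, -, -, -, -, -, -, -, h2', hb'⟩ :=
      D.comp p5 (D.dvdS p5 (by rw [hS]; exact h5.mul_left _))
    have hb' := bound_even (by omega) hb'
    have := five_pow_le (h2' (by norm_num))
    have : 2 ^ 5 ≤ 2 ^ s := Nat.pow_le_pow_right (by norm_num) (by omega)
    omega
  · obtain ⟨v, rfl⟩ : ∃ v, s = 2 * v + 1 := ⟨s / 2, by omega⟩
    set d := 2 ^ (v + 1) with hd
    have hd2 : 2 * 2 ^ (2 * v + 1) = d * d := by rw [hd]; ring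
    have hd4 : 4 ≤ d := by
      have : 2 ^ 2 ≤ 2 ^ (v + 1) := Nat.pow_le_pow_right (by norm_num) (by omega)
      omega
    have hP0 : 2 ^ (2 * v + 1 + 1) + 1 = d * d + 1 := by rw [← hd2]; ring
    have hdiv : ∀ r, r ∣ d * d + 1 → r ∣ sbu (2 ^ (2 * (2 * v + 1))) := by
      intro r hr
      rw [hS, hP0]; exact hr.mul_left _
    have hrp : (d * d + 1).minFac.Prime := Nat.minFac_prime (by nlinarith)
    have hrd := Nat.minFac_dvd (d * d + 1)
    have hsq : ¬ (d * d + 1).Prime → (d * d + 1).minFac ^ 2 ≤ d * d + 1 :=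
      Nat.minFac_sq_le_self (by positivity)
    have heq : (d * d + 1).Prime → (d * d + 1).minFac = d * d + 1 := fun h => h.minFac_eq
    generalize (d * d + 1).minFac = r at *
    obtain ⟨e, n, he', hn, hno, h, h3n, hs', hH, h4, h2, hb⟩ := D.comp hrp (D.dvdS hrp (hdiv r hrd))
    have hb := bound_even (by omega) hb
    rw [hd2] at hb
    have hro : Odd r := Odd.of_dvd_nat (sbu_two_pow_odd _) (hdiv r hrd)
    have hdev : Even d := by rw [hd, pow_succ]; simp
    have hr4 : r % 4 = 1 := by
      have := Fact.mk hrp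
      have h1 : (d : ZMod r) ^ 2 = -1 := zmod_P (by rw [pow_two]; exact hrd)
      have := ZMod.mod_four_ne_three_of_sq_eq_neg_one h1
      have := Nat.odd_iff.1 hro
      omega
    have he2 := h2 hr4
    have hprime : (d * d + 1).Prime := by
      by_contra hc
      have hsq := hsq hc
      have hne : r ≠ d := by
        rintro rfl
        exact Nat.not_even_iff_odd.2 hro hdev
      obtain rfl | rfl : e = 1 ∨ e = 2 := by omega
      · rw [pow_one] at hb
        have : d ≤ r := by nlinarith
        have := Nat.mul_le_mul this this
        nlinarith
      · rcases Nat.lt_or_ge r d with hlt | hge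
        · have : (r + 1) * (r + 1) ≤ d * d := Nat.mul_le_mul hlt hlt
          have : 2 ≤ r := hrp.two_le
          nlinarith
        · have : d + 1 ≤ r := by omega
          have := Nat.mul_le_mul this this
          nlinarith
    have hr := heq hprime
    obtain rfl | rfl : e = 1 ∨ e = 2 := by omega
    · rw [pow_one, sbu1 hrp, hr, ← hd2] at hH
      have hq3 : q = 3 := by
        refine hH.eq Nat.prime_three (by norm_num) ?_
        rw [pow_succ, pow_mul]
        have : (2 ^ 2) ^ v % 3 = 1 := by rw [Nat.pow_mod]; simp
        omega
      subst hq3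
      have htp : (2 ^ (2 * v + 1) - 1).minFac.Prime := Nat.minFac_prime (by omega)
      have htd := Nat.minFac_dvd (2 ^ (2 * v + 1) - 1)
      generalize (2 ^ (2 * v + 1) - 1).minFac = t at *
      have hdiv' : t ∣ sbu (2 ^ (2 * (2 * v + 1))) := by
        rw [hS]; exact htd.mul_right _
      have hto : Odd t := Odd.of_dvd_nat (sbu_two_pow_odd _) hdiv'
      obtain ⟨e', n', he'', -, -, -, -, -, hH', -, -, hb'⟩ := D.comp htp (D.dvdS htp hdiv')
      have hb' := bound_even (by omega) hb'
      refine no_three htp hto ?_ hH'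
      by_contra hc
      obtain rfl : e' = 1 := by omega
      have := Nat.le_of_dvd (by omega) htd
      rw [pow_one] at hb'
      omega
    · rw [sbu2 hrp, hr, ← hd2] at hH
      set x := 2 ^ (2 * v + 1) with hx
      have e1 : (2 * x + 1) ^ 2 + 1 = 2 * (2 * x * x + 2 * x + 1) := by ring
      rw [e1] at hH
      have hx5 : x % 5 = 3 := by
        obtain ⟨u, hu⟩ : ∃ u, 2 * v + 1 = 4 * u + 3 := ⟨v / 2, by omega⟩
        rw [hx, hu, pow_add, pow_mul]
        have : (2 ^ 4) ^ u % 5 = 1 := by rw [Nat.pow_mod]; simp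
        omega
      have hq5 : q = 5 := by
        refine hH.eq (r := 5) (by norm_num) (by norm_num) ?_
        apply Dvd.dvd.mul_left
        simp [Nat.dvd_iff_mod_eq_zero, Nat.add_mod, Nat.mul_mod, hx5]
      subst hq5
      have hW : 2 * x * x + 2 * x + 1 = 5 ^ (2 * x * x + 2 * x + 1).primeFactorsList.length := by
        apply Nat.eq_prime_pow_of_unique_prime_dvd (by omega)
        intro c hc hcd
        refine (hH.eq hc ?_ (hcd.mul_left _)).symm
        rintro rfl
        have : 2 * x * x = 2 * (x * x) := by ring
        omega
      exact W_not h3 hW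

lemma main {N f q g : ℕ} (D : Data N f q g) : N = 9 := by
  have hf := D.f0
  rcases Nat.even_or_odd' f with ⟨m, rfl | rfl⟩
  · exfalso
    rcases Nat.lt_or_ge 2 m with h | h
    · rcases Nat.even_or_odd m with h' | h'
      · exact case_even_even h h' D
      · exact case_even_odd h (Nat.odd_iff.1 h') D
    · obtain rfl | rfl : m = 1 ∨ m = 2 := by omega
      · exact case_two D
      · exact case_four D
  · rcases Nat.eq_zero_or_pos m with rfl | hm
    · exact case_one D
    · exact (case_odd hm D).elim

end BU

theorem stmt18 (N : ℕ) (hN : 0 < N) (hodd : Odd N) :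
    sbu (sbu N) = 2 * N ↔ N = 9 := by
  constructor
  · intro h
    obtain ⟨f, q, g, D⟩ := BU.exists_data hN hodd h
    exact BU.main D
  · rintro rfl
    have h9 : sbu 9 = 10 := by
      have := BU.sbu2 Nat.prime_three
      norm_num at this
      exact this
    have h10 : sbu 10 = 18 := by
      have := BU.sbu_mul (m := 2) (n := 5) (by norm_num) (by norm_num) (by norm_num)
      rw [BU.sbu1 Nat.prime_two, BU.sbu1 (by norm_num : Nat.Prime 5)] at this
      norm_num at this
      exact this
    rw [h9, h10]
end
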